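/- arXiv:2105.07307 — 5 statements merged into one kernel-verified Lean document; each statement's English description precedes it below -/
import Mathlib

section
/- Let i_1 < i_2 < ⋯ < i_s be positive integers and r ≥ 0 an integer with i_s + r ≤ n. Let I = sfBorel(x_{i_1}⋯x_{i_{s−1}} x_{i_s}) and J = sfBorel(x_{i_1}⋯x_{i_{s−1}} x_{i_s + r}), both in S = K[x_1,…,x_n]. Then ᾱ(I) = ᾱ(J). -/
open MvPolynomial

namespace SFB

/-- `B` is obtained from `A` by a single Borel move, where `A`, `B` are the
(1-based) supports of square-free monomials: some index `i ∈ A` is replaced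
by an index `j` with `1 ≤ j < i` not already in `A`. -/
def BorelMove (A B : Finset ℕ) : Prop :=
  ∃ i ∈ A, ∃ j, 1 ≤ j ∧ j < i ∧ j ∉ A ∧ B = insert j (A.erase i)

/-- `B` is obtained from `A` by finitely many Borel moves (possibly none). -/
def BorelReach (A B : Finset ℕ) : Prop :=
  Relation.ReflTransGen BorelMove A B

/-- The square-free monomial `∏_{r ∈ A} x_r` in `K[x_1,…,x_n]`,
where the variable `x_r` (for `1 ≤ r ≤ n`) is `X ⟨r-1,_⟩`. -/
noncomputable def sqfMon (K : Type*) [Field K] (n : ℕ) (A : Finset ℕ) :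
    MvPolynomial (Fin n) K :=
  ∏ j : Fin n, if (j : ℕ) + 1 ∈ A then X j else 1

/-- The square-free principal Borel ideal generated by the square-free
monomial with (1-based) support `A`, inside `K[x_1,…,x_n]`. -/
noncomputable def sfBorel (K : Type*) [Field K] (n : ℕ) (A : Finset ℕ) :
    Ideal (MvPolynomial (Fin n) K) :=
  Ideal.span {f | ∃ B, BorelReach A B ∧ f = sqfMon K n B}

/-- `α(J)`: the least degree of a nonzero homogeneous element of `J`. -/
noncomputable def alpha {K : Type*} [Field K] {n : ℕ}
    (J : Ideal (MvPolynomial (Fin n) K)) : ℕ :=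
  sInf {d | ∃ f ∈ J, f ≠ 0 ∧ MvPolynomial.IsHomogeneous f d}

/-- The `s`-th symbolic power of `I`: the intersection of the `s`-th powers
of the minimal primes of `I`. -/
noncomputable def symbPow {R : Type*} [CommRing R] (I : Ideal R) (s : ℕ) :
    Ideal R :=
  ⨅ P ∈ I.minimalPrimes, P ^ s

/-- The Waldschmidt constant `ᾱ(I) = inf_{s ≥ 1} α(I^{(s)})/s`
(which equals `lim_{s→∞} α(I^{(s)})/s`). -/
noncomputable def waldschmidt {K : Type*} [Field K] {n : ℕ}
    (I : Ideal (MvPolynomial (Fin n) K)) : ℝ :=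
  ⨅ s : ℕ+, (alpha (symbPow I (s : ℕ)) : ℝ) / ((s : ℕ) : ℝ)

/-- `t 0, t 1, …, t k` is the sequence `T(m)` associated to the square-free
monomial `m = x_{i 1} ⋯ x_{i s}` (with `i` strictly increasing on `1,…,s`):
`t 0 = s`, and for `1 ≤ j ≤ k`, `t j = max { r < t (j-1) | i r < i (r+1) - 1 }`,
with `k` the last index for which this maximum exists. -/
def IsTSeq (s : ℕ) (i : ℕ → ℕ) (t : ℕ → ℕ) (k : ℕ) : Prop :=
  t 0 = s ∧
  (∀ j, 1 ≤ j → j ≤ k →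
    1 ≤ t j ∧ t j < t (j - 1) ∧ i (t j) + 1 < i (t j + 1) ∧
    ∀ r, t j < r → r < t (j - 1) → ¬ (i r + 1 < i (r + 1))) ∧
  (∀ r, 1 ≤ r → r < t k → ¬ (i r + 1 < i (r + 1)))

end SFB

namespace SFB

/-- number of elements of `A` that are at most `t` -/
def cnt (A : Finset ℕ) (t : ℕ) : ℕ := (A.filter (· ≤ t)).card

def Dom (A B : Finset ℕ) : Prop := ∀ t, cnt A t ≤ cnt B t

lemma cnt_mono {A B : Finset ℕ} (h : A ⊆ B) (t : ℕ) : cnt A t ≤ cnt B t :=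
  Finset.card_le_card (Finset.filter_subset_filter _ h)

lemma cnt_le_card (A : Finset ℕ) (t : ℕ) : cnt A t ≤ A.card :=
  Finset.card_filter_le _ _

lemma cnt_insert {A : Finset ℕ} {x : ℕ} (h : x ∉ A) (t : ℕ) :
    cnt (insert x A) t = cnt A t + if x ≤ t then 1 else 0 := by
  unfold cnt
  rw [Finset.filter_insert]
  split_ifs with h1
  · rw [Finset.card_insert_of_notMem (by simp [h])]
  · simp

lemma cnt_erase {A : Finset ℕ} {x : ℕ} (h : x ∈ A) (t : ℕ) :
    cnt (A.erase x) t + (if x ≤ t then 1 else 0) = cnt A t := by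
  conv_rhs => rw [← Finset.insert_erase h]
  rw [cnt_insert (Finset.notMem_erase x A)]

lemma move_dom {A B : Finset ℕ} (h : BorelMove A B) : Dom A B := by
  obtain ⟨i, hi, j, h1, hj, hjA, rfl⟩ := h
  intro t
  rw [cnt_insert (by simp [hjA]), ← cnt_erase hi t]
  split_ifs <;> omega

lemma reach_dom {A B : Finset ℕ} (h : BorelReach A B) : Dom A B := by
  induction h with
  | refl => exact fun t => le_rfl
  | tail _ h2 ih => exact fun t => (ih t).trans (move_dom h2 t)

lemma reach_range {A B : Finset ℕ} {n : ℕ} (h : BorelReach A B)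
    (hA : ∀ x ∈ A, 1 ≤ x ∧ x ≤ n) : ∀ x ∈ B, 1 ≤ x ∧ x ≤ n := by
  induction h with
  | refl => exact hA
  | tail _ h2 ih =>
    obtain ⟨i, hi, j, h1, hj, hjA, rfl⟩ := h2
    intro x hx
    have := ih i hi
    rcases Finset.mem_insert.1 hx with rfl | hx
    · omega
    · exact ih x (Finset.mem_of_mem_erase hx)

lemma dom_reach_aux : ∀ (k : ℕ) (A B : Finset ℕ), (A \ B).card = k → A.card = B.card →
    (∀ x ∈ B, 1 ≤ x) → Dom A B → BorelReach A B := by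
  intro k
  induction k with
  | zero =>
    intro A B h hc _ _
    have h1 : A ⊆ B := by
      rw [← Finset.sdiff_eq_empty_iff_subset]; exact Finset.card_eq_zero.1 h
    rw [Finset.eq_of_subset_of_card_le h1 hc.ge]
    exact Relation.ReflTransGen.refl
  | succ k ih =>
    intro A B h hc hB hD
    have hne : (A \ B).Nonempty := Finset.card_pos.1 (by omega)
    have hne' : (B \ A).Nonempty := by
      rw [← Finset.card_pos, ← Finset.card_sdiff_comm hc]; omega
    obtain ⟨i, hi, himin⟩ := Finset.exists_min_image (A \ B) id hne
    obtain ⟨j, hj, hjmin⟩ := Finset.exists_min_image (B \ A) id hne'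
    simp only [Finset.mem_sdiff, id] at hi hj himin hjmin
    have hij : j < i := by
      by_contra hcon
      have hne : i ≠ j := by rintro rfl; exact hi.2 hj.1
      have h1 : insert i (B.filter (· ≤ i)) ⊆ A.filter (· ≤ i) := by
        intro x hx
        rcases Finset.mem_insert.1 hx with rfl | hx
        · simp [hi.1]
        · simp only [Finset.mem_filter] at hx ⊢
          refine ⟨?_, hx.2⟩
          by_contra hxA
          have := hjmin x ⟨hx.1, hxA⟩
          omega
      have h2 := Finset.card_le_card h1
      rw [Finset.card_insert_of_notMem (by simp [hi.2])] at h2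
      have := hD i
      unfold cnt at this
      omega
    have hmv : BorelMove A (insert j (A.erase i)) := ⟨i, hi.1, j, hB j hj.1, hij, hj.2, rfl⟩
    refine Relation.ReflTransGen.head hmv (ih _ _ ?_ ?_ hB ?_)
    · have : insert j (A.erase i) \ B = (A \ B).erase i := by
        ext x
        simp only [Finset.mem_sdiff, Finset.mem_insert, Finset.mem_erase]
        constructor
        · rintro ⟨rfl | h1, h2⟩
          · exact absurd hj.1 h2
          · exact ⟨h1.1, h1.2, h2⟩
        · rintro ⟨h1, h2, h3⟩
          exact ⟨Or.inr ⟨h1, h2⟩, h3⟩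
      rw [this, Finset.card_erase_of_mem (by simp [hi])]
      omega
    · rw [Finset.card_insert_of_notMem (by simp [hj.2]), Finset.card_erase_of_mem hi.1, ← hc]
      have := Finset.card_pos.2 ⟨i, hi.1⟩
      omega
    · intro t
      have e1 := cnt_erase hi.1 t
      have e2 := hD t
      rw [cnt_insert (by simp [hj.2])]
      by_cases ht : i ≤ t
      · have : j ≤ t := by omega
        simp only [ht, this, if_true] at e1 ⊢
        omega
      · by_cases hjt : j ≤ t
        · have h1 : insert j (A.filter (· ≤ t)) ⊆ B.filter (· ≤ t) := by
            intro x hx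
            rcases Finset.mem_insert.1 hx with rfl | hx
            · simp [hj.1, hjt]
            · simp only [Finset.mem_filter] at hx ⊢
              refine ⟨?_, hx.2⟩
              by_contra hxA
              have := himin x ⟨hx.1, hxA⟩
              omega
          have h2 := Finset.card_le_card h1
          rw [Finset.card_insert_of_notMem (by simp [hj.2])] at h2
          simp only [ht, hjt, if_true, if_false] at e1 ⊢
          unfold cnt at *
          omega
        · simp only [ht, hjt, if_false] at e1 ⊢
          omega

lemma dom_exists_reach : ∀ (k : ℕ) (A C : Finset ℕ), C.card = k → A.card ≤ C.card →
    (∀ x ∈ C, 1 ≤ x) → Dom A C → ∃ B ⊆ C, BorelReach A B := by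
  intro k
  induction k with
  | zero =>
    intro A C hk hc hC hD
    exact ⟨C, subset_rfl, dom_reach_aux _ A C rfl (by omega) hC hD⟩
  | succ k ih =>
    intro A C hk hc hC hD
    by_cases hac : A.card = C.card
    · exact ⟨C, subset_rfl, dom_reach_aux _ A C rfl hac hC hD⟩
    obtain ⟨x, hx, hmax⟩ := Finset.exists_max_image C id (Finset.card_pos.1 (by omega))
    have hce := Finset.card_erase_of_mem hx
    obtain ⟨B, hB, hr⟩ := ih A (C.erase x) (by omega) (by omega)
      (fun y hy => hC y (Finset.mem_of_mem_erase hy)) (by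
        intro t
        have e1 := cnt_erase hx t
        by_cases ht : x ≤ t
        · have : cnt (C.erase x) t = (C.erase x).card := by
            unfold cnt
            rw [Finset.filter_true_of_mem]
            intro y hy
            exact (hmax y (Finset.mem_of_mem_erase hy)).trans ht
          rw [this]
          have := cnt_le_card A t
          omega
        · have := hD t
          simp only [ht, if_false] at e1
          omega)
    exact ⟨B, hB.trans (Finset.erase_subset _ _), hr⟩

/-- count of elements of `C` among the first `t` variables -/
def cntF {n : ℕ} (C : Finset (Fin n)) (t : ℕ) : ℕ := (C.filter (fun j => j.val < t)).card

lemma cnt_image {n : ℕ} (C : Finset (Fin n)) (t : ℕ) :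
    cnt (C.image (fun j => j.val + 1)) t = cntF C t := by
  unfold cnt cntF
  rw [Finset.filter_image, Finset.card_image_of_injective]
  · rfl
  · intro a b h
    simp only [add_left_inj] at h
    exact Fin.ext h

/-- exponent vectors of monomials in the `m`-th symbolic power -/
def Feas {n : ℕ} (A : Finset ℕ) (a : Fin n → ℕ) (m : ℕ) : Prop :=
  ∀ (C : Finset (Fin n)) (t : ℕ), cntF C t < cnt A t → m ≤ ∑ j ∈ Cᶜ, a j

/-- If every reachable support meets the complement of `C` then `C` is not dominating. -/
lemma cover_of_hits {n : ℕ} (A : Finset ℕ) (hA : ∀ x ∈ A, 1 ≤ x ∧ x ≤ n) (C : Finset (Fin n))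
    (h : ∀ B, BorelReach A B → ∃ j : Fin n, j.val + 1 ∈ B ∧ j ∉ C) :
    ∃ t, cntF C t < cnt A t := by
  by_contra hcon
  push Not at hcon
  have hD : Dom A (C.image (fun j => j.val + 1)) := by
    intro t; rw [cnt_image]; exact hcon t
  have hcard : A.card ≤ (C.image (fun j => j.val + 1)).card := by
    have h1 : cnt A n = A.card := by
      unfold cnt; rw [Finset.filter_true_of_mem]; exact fun x hx => (hA x hx).2
    rw [← h1]
    exact (hD n).trans (cnt_le_card _ _)
  obtain ⟨B, hB, hr⟩ := dom_exists_reach _ A _ rfl hcard (by simp) hD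
  obtain ⟨j, hj, hjC⟩ := h B hr
  have := hB hj
  simp only [Finset.mem_image] at this
  obtain ⟨k, hk, e⟩ := this
  have : k = j := Fin.ext (by omega)
  subst this
  exact hjC hk

lemma hits_of_cover {n : ℕ} (A : Finset ℕ) (hA : ∀ x ∈ A, 1 ≤ x ∧ x ≤ n) (C : Finset (Fin n))
    (t : ℕ) (h : cntF C t < cnt A t) (B : Finset ℕ) (hB : BorelReach A B) :
    ∃ j : Fin n, j.val + 1 ∈ B ∧ j ∉ C := by
  by_contra hcon
  push Not at hcon
  have hsub : B ⊆ C.image (fun j => j.val + 1) := by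
    intro x hx
    have := reach_range hB hA x hx
    refine Finset.mem_image.2 ⟨⟨x - 1, by omega⟩, hcon _ ?_, ?_⟩
    · simpa [Nat.sub_add_cancel this.1] using hx
    · simp [Nat.sub_add_cancel this.1]
  have h1 := reach_dom hB t
  have h2 := cnt_mono hsub t
  rw [cnt_image] at h2
  omega

section algebra
variable {K : Type*} [Field K] {n : ℕ}

/-- polynomials all of whose monomials have `P`-degree at least `m` -/
def degIdeal (K : Type*) [Field K] {n : ℕ} (P : Finset (Fin n)) (m : ℕ) :
    Ideal (MvPolynomial (Fin n) K) where
  carrier := {f | ∀ d ∈ f.support, m ≤ ∑ j ∈ P, d j}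
  zero_mem' := by simp
  add_mem' := by
    classical
    intro f g hf hg d hd
    rcases Finset.mem_union.1 (MvPolynomial.support_add hd) with h | h
    · exact hf d h
    · exact hg d h
  smul_mem' := by
    classical
    intro c f hf d hd
    rw [smul_eq_mul] at hd
    obtain ⟨u, hu, v, hv, rfl⟩ := Finset.mem_add.1 (MvPolynomial.support_mul _ _ hd)
    have := hf v hv
    simp only [Finsupp.add_apply, Finset.sum_add_distrib]
    omega

lemma degIdeal_pow (P : Finset (Fin n)) (m : ℕ) :
    degIdeal K P 1 ^ m ≤ degIdeal K P m := by
  classical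
  induction m with
  | zero => intro f _ d _; exact Nat.zero_le _
  | succ m ih =>
    rw [pow_succ, Ideal.mul_le]
    intro f hf g hg d hd
    obtain ⟨u, hu, v, hv, rfl⟩ := Finset.mem_add.1 (MvPolynomial.support_mul _ _ hd)
    have h1 := ih hf u hu
    have h2 := hg v hv
    simp only [Finsupp.add_apply, Finset.sum_add_distrib]
    omega

lemma span_le_degIdeal (P : Finset (Fin n)) :
    Ideal.span ((X : Fin n → MvPolynomial (Fin n) K) '' (P : Set (Fin n))) ≤ degIdeal K P 1 := by
  classical
  rw [Ideal.span_le]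
  rintro _ ⟨j, hj, rfl⟩ d hd
  rw [MvPolynomial.support_X, Finset.mem_singleton] at hd
  subst hd
  calc 1 = (Finsupp.single j 1 : Fin n →₀ ℕ) j := by simp
    _ ≤ _ := Finset.single_le_sum (f := fun i => (Finsupp.single j 1 : Fin n →₀ ℕ) i)
        (fun _ _ => Nat.zero_le _) hj

/-- substitute zero for the variables in `P` -/
noncomputable def killP (K : Type*) [Field K] {n : ℕ} (P : Finset (Fin n)) :
    MvPolynomial (Fin n) K →ₐ[K] MvPolynomial (Fin n) K :=
  MvPolynomial.aeval (fun j => if j ∈ P then 0 else X j)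

lemma ker_killP (P : Finset (Fin n)) :
    RingHom.ker (killP K P) ≤ degIdeal K P 1 := by
  refine le_trans ?_ (span_le_degIdeal P)
  intro f hf
  set S := Ideal.span ((X : Fin n → MvPolynomial (Fin n) K) '' (P : Set (Fin n))) with hS
  have h : (Ideal.Quotient.mkₐ K S).comp (killP K P) = Ideal.Quotient.mkₐ K S := by
    apply MvPolynomial.algHom_ext
    intro j
    simp only [AlgHom.comp_apply, killP, MvPolynomial.aeval_X]
    split_ifs with hj
    · rw [map_zero]
      symm
      exact Ideal.Quotient.eq_zero_iff_mem.2 (Ideal.subset_span ⟨j, hj, rfl⟩)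
    · rfl
  have h2 := congrArg (fun φ => φ f) h
  simp only [AlgHom.comp_apply] at h2
  rw [RingHom.mem_ker] at hf
  rw [hf, map_zero] at h2
  exact Ideal.Quotient.eq_zero_iff_mem.1 h2.symm

lemma feas_of_mem {A : Finset ℕ} (hA : ∀ x ∈ A, 1 ≤ x ∧ x ≤ n) {m : ℕ}
    {f : MvPolynomial (Fin n) K} (hf : f ∈ symbPow (sfBorel K n A) m)
    {d : Fin n →₀ ℕ} (hd : d ∈ f.support) : Feas A d m := by
  intro C t hC
  have hprime : (RingHom.ker (killP K Cᶜ)).IsPrime := RingHom.ker_isPrime _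
  have hle : sfBorel K n A ≤ RingHom.ker (killP K Cᶜ) := by
    unfold sfBorel
    rw [Ideal.span_le]
    rintro _ ⟨B, hB, rfl⟩
    obtain ⟨j, hj, hjC⟩ := hits_of_cover A hA C t hC B hB
    refine (Ideal.IsPrime.prod_mem_iff (p := RingHom.ker (killP K Cᶜ))).2
      ⟨j, Finset.mem_univ j, ?_⟩
    rw [if_pos hj, RingHom.mem_ker]
    simp [killP, hjC]
  obtain ⟨Q, hQ, hQle⟩ := Ideal.exists_minimalPrimes_le hle
  have h1 : f ∈ Q ^ m := by
    unfold symbPow at hf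
    simp only [Ideal.mem_iInf] at hf
    exact hf Q hQ
  exact degIdeal_pow _ _ (Ideal.pow_right_mono (hQle.trans (ker_killP _)) m h1) d hd

lemma mem_of_feas {A : Finset ℕ} (hA : ∀ x ∈ A, 1 ≤ x ∧ x ≤ n) {m : ℕ}
    {d : Fin n →₀ ℕ} (hd : Feas A d m) :
    monomial d (1 : K) ∈ symbPow (sfBorel K n A) m := by
  classical
  unfold symbPow
  simp only [Ideal.mem_iInf]
  intro Q hQ
  have hprime : Q.IsPrime := hQ.1.1
  set C : Finset (Fin n) := Finset.univ.filter (fun j => (X j : MvPolynomial (Fin n) K) ∉ Q)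
    with hCdef
  obtain ⟨t, ht⟩ := cover_of_hits A hA C (by
    intro B hB
    have h1 : sqfMon K n B ∈ Q := hQ.1.2 (Ideal.subset_span ⟨B, hB, rfl⟩)
    obtain ⟨j, _, hj⟩ := Ideal.IsPrime.prod_mem_iff.1 h1
    by_cases hjB : j.val + 1 ∈ B
    · rw [if_pos hjB] at hj
      exact ⟨j, hjB, by simp [hCdef, hj]⟩
    · rw [if_neg hjB] at hj
      exact absurd ((Ideal.eq_top_iff_one _).2 hj) hprime.ne_top)
  have h2 := hd C t ht
  apply Ideal.pow_le_pow_right h2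
  rw [MvPolynomial.monomial_eq, map_one, one_mul,
    Finsupp.prod_fintype _ _ (by simp), ← Finset.prod_compl_mul_prod C]
  apply Ideal.mul_mem_right
  rw [← Finset.prod_pow_eq_pow_sum]
  apply Ideal.prod_mem_prod
  intro j hj
  apply Ideal.pow_mem_pow
  simpa [hCdef] using hj

lemma alpha_eq {A : Finset ℕ} (hA : ∀ x ∈ A, 1 ≤ x ∧ x ≤ n) (m : ℕ) :
    alpha (symbPow (sfBorel K n A) m) =
      sInf {d | ∃ a : Fin n → ℕ, Feas A a m ∧ ∑ j, a j = d} := by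
  unfold alpha
  congr 1
  ext d
  constructor
  · rintro ⟨f, hf, hf0, hhom⟩
    obtain ⟨u, hu⟩ := MvPolynomial.ne_zero_iff.1 hf0
    refine ⟨u, feas_of_mem hA hf (MvPolynomial.mem_support_iff.2 hu), ?_⟩
    have := hhom hu
    rw [← this, ← Finsupp.degree_eq_sum, Finsupp.degree_eq_weight_one]
    rfl
  · rintro ⟨a, ha, rfl⟩
    refine ⟨monomial (Finsupp.equivFunOnFinite.symm a) 1, mem_of_feas hA (by simpa using ha), ?_, ?_⟩
    · simp
    · apply MvPolynomial.isHomogeneous_monomial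
      rw [Finsupp.degree_eq_sum]
      simp

lemma feas_const {A : Finset ℕ} (hA : ∀ x ∈ A, 1 ≤ x ∧ x ≤ n) (m : ℕ) :
    Feas A (fun _ : Fin n => m) m := by
  intro C t h
  have : Cᶜ.Nonempty := by
    by_contra hcon
    rw [Finset.not_nonempty_iff_eq_empty, Finset.compl_eq_empty_iff] at hcon
    subst hcon
    have : cnt A t ≤ cnt (Finset.univ.image (fun j : Fin n => j.val + 1)) t := by
      apply cnt_mono
      intro x hx
      have := hA x hx
      exact Finset.mem_image.2 ⟨⟨x - 1, by omega⟩, Finset.mem_univ _, by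
        simp [Nat.sub_add_cancel this.1]⟩
    rw [cnt_image] at this
    omega
  rw [Finset.sum_const, smul_eq_mul]
  exact Nat.le_mul_of_pos_left _ (Finset.card_pos.2 this)

end algebra

section comb
variable {n : ℕ}

/-- only the first `t` variables matter -/
lemma Feas.restrict {A : Finset ℕ} {a : Fin n → ℕ} {m : ℕ} (h : Feas A a m)
    (C : Finset (Fin n)) (t : ℕ) (hC : cntF C t < cnt A t) :
    m ≤ ∑ j ∈ Cᶜ.filter (fun j => j.val < t), a j := by
  have h1 := h (C ∪ Finset.univ.filter (fun j => ¬ j.val < t)) t (by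
    unfold cntF at *
    have e : (C ∪ Finset.univ.filter (fun j => ¬ j.val < t)).filter (fun j => j.val < t) =
        C.filter (fun j => j.val < t) := by
      ext j
      simp only [Finset.mem_filter, Finset.mem_union, Finset.mem_univ, true_and]
      tauto
    rw [e]
    exact hC)
  refine h1.trans (le_of_eq ?_)
  congr 1
  ext j
  simp

lemma Feas.swap {A : Finset ℕ} {a : Fin n → ℕ} {m : ℕ} (h : Feas A a m)
    {j k : Fin n} (hjk : j < k) (ha : a j ≤ a k) : Feas A (a ∘ Equiv.swap j k) m := by
  intro C t hC
  by_cases hk : k.val < t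
  · have hj : j.val < t := lt_trans hjk hk
    have hlt : ∀ x : Fin n, (Equiv.swap j k x).val < t ↔ x.val < t := by
      intro x
      rcases eq_or_ne x j with rfl | h1
      · simp [hj, hk]
      rcases eq_or_ne x k with rfl | h2
      · simp [hj, hk]
      rw [Equiv.swap_apply_of_ne_of_ne h1 h2]
    have h1 := h (C.map (Equiv.swap j k).toEmbedding) t (by
      unfold cntF at *
      rw [Finset.filter_map, Finset.card_map]
      convert hC using 3
      simp [hlt])
    refine h1.trans (le_of_eq ?_)
    have : (C.map (Equiv.swap j k).toEmbedding)ᶜ = Cᶜ.map (Equiv.swap j k).toEmbedding := by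
      ext x
      simp [Finset.mem_map_equiv]
    rw [this, Finset.sum_map]
    rfl
  · refine (h.restrict C t hC).trans ?_
    refine le_trans ?_ (Finset.sum_le_sum_of_subset (Finset.filter_subset (fun j => j.val < t) _))
    apply Finset.sum_le_sum
    intro x hx
    simp only [Finset.mem_filter] at hx
    have h2 : x ≠ k := by rintro rfl; exact hk hx.2
    rcases eq_or_ne x j with rfl | h1
    · simpa using ha
    · simp [Equiv.swap_apply_of_ne_of_ne h1 h2]

lemma Feas.sort {A : Finset ℕ} {m : ℕ} {a : Fin n → ℕ} (h : Feas A a m) :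
    ∃ b : Fin n → ℕ, Feas A b m ∧ ∑ j, b j = ∑ j, a j ∧ ∀ j k, j < k → b k ≤ b j := by
  classical
  have hex : ∃ w, ∃ b : Fin n → ℕ, Feas A b m ∧ ∑ j, b j = ∑ j, a j ∧
      ∑ j, j.val * b j = w := ⟨_, a, h, rfl, rfl⟩
  obtain ⟨b, hb, hsum, hw⟩ := Nat.find_spec hex
  refine ⟨b, hb, hsum, ?_⟩
  intro j k hjk
  by_contra hcon
  push Not at hcon
  have hne : j ≠ k := hjk.ne
  refine Nat.find_min hex (m := ∑ x, x.val * (b ∘ Equiv.swap j k) x) ?_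
    ⟨_, hb.swap hjk hcon.le, ?_, rfl⟩
  · rw [← hw]
    rw [← Finset.add_sum_erase _ _ (Finset.mem_univ j), ← Finset.add_sum_erase _ _ (Finset.mem_univ j),
      ← Finset.add_sum_erase (Finset.univ.erase j) _ (Finset.mem_erase.2 ⟨hne.symm, Finset.mem_univ k⟩),
      ← Finset.add_sum_erase (Finset.univ.erase j) (fun x => x.val * b x)
        (Finset.mem_erase.2 ⟨hne.symm, Finset.mem_univ k⟩)]
    have : ∑ x ∈ (Finset.univ.erase j).erase k, x.val * (b ∘ Equiv.swap j k) x =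
        ∑ x ∈ (Finset.univ.erase j).erase k, x.val * b x := by
      apply Finset.sum_congr rfl
      intro x hx
      simp only [Finset.mem_erase] at hx
      simp [Equiv.swap_apply_of_ne_of_ne hx.2.1 hx.1]
    rw [this]
    simp only [Function.comp, Equiv.swap_apply_left, Equiv.swap_apply_right]
    have : j.val < k.val := hjk
    nlinarith
  · rw [← hsum]
    exact Equiv.sum_comp (Equiv.swap j k) b

/-- discrete intermediate value for sums -/
lemma exists_between {ι : Type*} [DecidableEq ι] (W : Finset ι) (f g : ι → ℕ) (hfg : ∀ i, f i ≤ g i) :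
    ∀ N, ∑ i ∈ W, f i ≤ N → N ≤ ∑ i ∈ W, g i →
      ∃ h : ι → ℕ, (∀ i, f i ≤ h i ∧ h i ≤ g i) ∧ ∑ i ∈ W, h i = N := by
  intro N
  induction N with
  | zero => exact fun h1 _ => ⟨f, fun i => ⟨le_rfl, hfg i⟩, by omega⟩
  | succ N ih =>
    intro h1 h2
    rcases Nat.lt_or_ge N (∑ i ∈ W, f i) with h3 | h3
    · exact ⟨f, fun i => ⟨le_rfl, hfg i⟩, by omega⟩
    obtain ⟨h, hh, hs⟩ := ih h3 (by omega)
    obtain ⟨x, hx, hlt⟩ := Finset.exists_lt_of_sum_lt (s := W) (f := h) (g := g) (by omega)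
    refine ⟨Function.update h x (h x + 1), ?_, ?_⟩
    · intro i
      rcases eq_or_ne i x with rfl | hne
      · have := hh i
        simp; omega
      · simpa [hne] using hh i
    · rw [Finset.sum_update_of_mem hx, ← hs, ← Finset.add_sum_erase _ _ hx,
        Finset.sdiff_singleton_eq_erase]
      omega

lemma sum_le_of_separated {ι : Type*} [DecidableEq ι] (W P : Finset ι) (b : ι → ℕ) (c : ℕ)
    (hcard : W.card ≤ P.card) (h1 : ∀ i ∈ W \ P, b i ≤ c) (h2 : ∀ i ∈ P \ W, c ≤ b i) :
    ∑ i ∈ W, b i ≤ ∑ i ∈ P, b i := by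
  have e1 := Finset.sum_inter_add_sum_sdiff W P b
  have e2 := Finset.sum_inter_add_sum_sdiff P W b
  rw [Finset.inter_comm] at e2
  have c1 := Finset.card_inter_add_card_sdiff W P
  have c2 := Finset.card_inter_add_card_sdiff P W
  rw [Finset.inter_comm] at c2
  have s1 : ∑ i ∈ W \ P, b i ≤ _ := Finset.sum_le_card_nsmul _ _ _ h1
  have s2 : _ ≤ ∑ i ∈ P \ W, b i := Finset.card_nsmul_le_sum _ _ _ h2
  have : (W \ P).card * c ≤ (P \ W).card * c := Nat.mul_le_mul_right _ (by omega)
  simp only [smul_eq_mul] at s1 s2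
  omega

lemma card_window {n : ℕ} (u v : ℕ) (hv : v ≤ n) :
    ((Finset.univ : Finset (Fin n)).filter (fun j => u ≤ j.val ∧ j.val < v)).card = v - u := by
  rw [← Nat.card_Ico u v, ← Finset.card_map Fin.valEmbedding]
  congr 1
  ext x
  simp only [Finset.mem_map, Finset.mem_filter, Finset.mem_univ, true_and, Finset.mem_Ico,
    Fin.valEmbedding_apply]
  constructor
  · rintro ⟨y, hy, rfl⟩; exact hy
  · intro h; exact ⟨⟨x, by omega⟩, h, rfl⟩

lemma feas_main {A : Finset ℕ} {p r m : ℕ} (hA : ∀ x ∈ A, 1 ≤ x ∧ x < p) (hp : 1 ≤ p)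
    (hn : p + r ≤ n) {a : Fin n → ℕ} (ha : Feas (insert (p + r) A) a m)
    (hmono : ∀ j k, j < k → a k ≤ a j) :
    ∃ b : Fin n → ℕ, Feas (insert p A) b ((p - A.card) * m) ∧
      ∑ j, b j ≤ (p - A.card) * ∑ j, a j := by
  classical
  have hmono' : ∀ j k, j ≤ k → a k ≤ a j := by
    intro j k h
    rcases h.lt_or_eq with h | rfl
    · exact hmono j k h
    · exact le_rfl
  set u := A.card with hu
  have hup : u < p := by
    have h1 : A ⊆ Finset.Ico 1 p := fun x hx => Finset.mem_Ico.2 (hA x hx)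
    have h2 := Finset.card_le_card h1
    rw [Nat.card_Ico] at h2
    omega
  obtain ⟨L, hL⟩ : ∃ L, L = p - u := ⟨_, rfl⟩
  rw [← hL]
  have hpA : p ∉ A := fun h => by have := hA p h; omega
  have hprA : p + r ∉ A := fun h => by have := hA _ h; omega
  have hcntA : ∀ t, p - 1 ≤ t → cnt A t = u := by
    intro t ht
    unfold cnt
    rw [Finset.filter_true_of_mem]
    intro x hx
    have := hA x hx
    omega
  -- a consequence of feasibility: sums over windows
  have hwin : ∀ v t, v < cnt (insert (p + r) A) t →
      m ≤ ∑ j ∈ Finset.univ.filter (fun j : Fin n => v ≤ j.val ∧ j.val < t), a j := by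
    intro v t hv
    refine (ha.restrict (Finset.univ.filter (fun j : Fin n => j.val < v)) t ?_).trans
      (le_of_eq ?_)
    · refine lt_of_le_of_lt ?_ hv
      unfold cntF
      refine (Finset.card_filter_le _ _).trans ?_
      rw [← Finset.card_map Fin.valEmbedding]
      have : (Finset.univ.filter (fun j : Fin n => j.val < v)).map Fin.valEmbedding ⊆
          Finset.range v := by
        intro x hx
        simp only [Finset.mem_map, Finset.mem_filter, Finset.mem_univ, true_and,
          Fin.valEmbedding_apply] at hx
        obtain ⟨y, hy, rfl⟩ := hx
        simpa using hy
      simpa using Finset.card_le_card this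
    · congr 1
      ext j
      simp
  set W : Finset (Fin n) := Finset.univ.filter (fun j : Fin n => u ≤ j.val ∧ j.val < p) with hW
  have hWcard : W.card = L := by rw [hW, card_window u p (by omega), hL]
  -- the window of `J`
  have hJ : m ≤ ∑ j ∈ Finset.univ.filter (fun j : Fin n => u ≤ j.val ∧ j.val < p + r), a j := by
    apply hwin
    rw [cnt_insert hprA, hcntA _ (by omega)]
    simp
  -- values before the window are large
  have hbig : ∀ j : Fin n, j.val < u → m ≤ L * a j := by
    intro j hj
    have h1 := hwin (u - 1) (p - 1) (by
      rw [cnt_insert hprA, hcntA _ le_rfl]; omega)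
    refine h1.trans ?_
    have h2 := Finset.sum_le_card_nsmul
      (Finset.univ.filter (fun j : Fin n => u - 1 ≤ j.val ∧ j.val < p - 1)) a (a j) (by
        intro k hk
        simp only [Finset.mem_filter] at hk
        exact hmono' j k (by rw [Fin.le_def]; omega))
    rw [card_window _ _ (by omega), smul_eq_mul] at h2
    have : p - 1 - (u - 1) = L := by omega
    rw [this] at h2
    exact h2
  -- fill the window
  obtain ⟨h, hh, hhW⟩ := exists_between W (fun j => L * a j) (fun j => max (L * a j) m)
    (fun j => le_max_left _ _) (max (L * m) (∑ j ∈ W, L * a j)) (le_max_right _ _) (by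
      apply max_le
      · have := Finset.card_nsmul_le_sum W (fun j => max (L * a j) m) m
          (fun j _ => le_max_right _ _)
        rwa [hWcard, smul_eq_mul] at this
      · exact Finset.sum_le_sum (fun j _ => le_max_left _ _))
  let b : Fin n → ℕ := fun j => if j.val < u then L * a j else if j.val < p then h j else 0
  have hbW : ∑ j ∈ W, b j = max (L * m) (∑ j ∈ W, L * a j) := by
    rw [← hhW]
    apply Finset.sum_congr rfl
    intro j hj
    simp only [hW, Finset.mem_filter] at hj
    simp only [b]
    rw [if_neg (by omega), if_pos hj.2.2]
  have hbge : ∀ j : Fin n, j.val < p → L * a j ≤ b j := by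
    intro j hj
    simp only [b]
    split_ifs
    · exact le_rfl
    · exact (hh j).1
  refine ⟨b, ?_, ?_⟩
  · intro C t hC
    by_cases ht : t < p
    · have h1 : cntF C t < cnt (insert (p + r) A) t := by
        rw [cnt_insert hpA, if_neg (by omega)] at hC
        rw [cnt_insert hprA]
        omega
      have h2 := ha.restrict C t h1
      calc L * m ≤ L * ∑ j ∈ Cᶜ.filter (fun j => j.val < t), a j := Nat.mul_le_mul_left _ h2
        _ = ∑ j ∈ Cᶜ.filter (fun j => j.val < t), L * a j := Finset.mul_sum _ _ _
        _ ≤ ∑ j ∈ Cᶜ.filter (fun j => j.val < t), b j := by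
            apply Finset.sum_le_sum
            intro j hj
            simp only [Finset.mem_filter] at hj
            exact hbge j (by omega)
        _ ≤ _ := Finset.sum_le_sum_of_subset (Finset.filter_subset _ _)
    · rw [cnt_insert hpA, hcntA _ (by omega), if_pos (by omega)] at hC
      have hCp : (C.filter (fun j => j.val < p)).card ≤ u := by
        have : (C.filter (fun j => j.val < p)).card ≤ cntF C t := by
          apply Finset.card_le_card
          intro x hx
          simp only [Finset.mem_filter] at hx ⊢
          exact ⟨hx.1, by omega⟩
        omega
      set P := Cᶜ.filter (fun j => j.val < p) with hP
      have hPcard : W.card ≤ P.card := by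
        have e1 := card_window (n := n) 0 p (by omega)
        have e2 : (Finset.univ : Finset (Fin n)).filter (fun j => 0 ≤ j.val ∧ j.val < p) =
            (C.filter (fun j => j.val < p)) ∪ P := by
          ext j
          simp only [hP, Finset.mem_filter, Finset.mem_univ, Finset.mem_union, Finset.mem_compl,
            true_and]
          have := Nat.zero_le j.val
          tauto
        rw [e2] at e1
        have := Finset.card_union_le (C.filter (fun j => j.val < p)) P
        omega
      have hsep : ∃ c, (∀ j ∈ W \ P, b j ≤ c) ∧ (∀ j ∈ P \ W, c ≤ b j) := by
        have hPW : ∀ j ∈ P \ W, j.val < u := by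
          intro j hj
          simp only [hP, hW, Finset.mem_sdiff, Finset.mem_filter, Finset.mem_univ, true_and] at hj
          omega
        rcases Nat.eq_zero_or_pos u with hu0 | hu0
        · refine ⟨∑ j, b j, fun j _ => Finset.single_le_sum (fun _ _ => Nat.zero_le _)
            (Finset.mem_univ j), fun j hj => ?_⟩
          have := hPW j hj
          omega
        · let e : Fin n := ⟨u - 1, by omega⟩
          refine ⟨L * a e, ?_, ?_⟩
          · intro j hj
            simp only [hW, Finset.mem_sdiff, Finset.mem_filter, Finset.mem_univ, true_and] at hj
            simp only [b]
            rw [if_neg (by omega), if_pos hj.1.2]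
            refine (hh j).2.trans (max_le ?_ ?_)
            · exact Nat.mul_le_mul_left _ (hmono' e j (by
                rw [Fin.le_def]; simp only [e]; omega))
            · exact hbig e (by simp only [e]; omega)
          · intro j hj
            have := hPW j hj
            simp only [b]
            rw [if_pos this]
            exact Nat.mul_le_mul_left _ (hmono' j e (by
                rw [Fin.le_def]; simp only [e]; omega))
      obtain ⟨c, hc1, hc2⟩ := hsep
      calc L * m ≤ ∑ j ∈ W, b j := by rw [hbW]; exact le_max_left _ _
        _ ≤ ∑ j ∈ P, b j := sum_le_of_separated W P b c hPcard hc1 hc2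
        _ ≤ _ := Finset.sum_le_sum_of_subset (Finset.filter_subset _ _)
  · rw [← Finset.sum_filter_add_sum_filter_not Finset.univ (fun j : Fin n => j.val < u) b,
      ← Finset.sum_filter_add_sum_filter_not Finset.univ (fun j : Fin n => j.val < u) a, mul_add]
    apply Nat.add_le_add
    · rw [Finset.mul_sum]
      apply Finset.sum_le_sum
      intro j hj
      simp only [Finset.mem_filter] at hj
      simp only [b]
      rw [if_pos hj.2]
    · have e1 : ∑ j ∈ Finset.univ.filter (fun j : Fin n => ¬ j.val < u), b j = ∑ j ∈ W, b j := by
        symm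
        apply Finset.sum_subset
        · intro j hj
          simp only [hW, Finset.mem_filter, Finset.mem_univ, true_and] at hj ⊢
          omega
        · intro j hj hj'
          simp only [hW, Finset.mem_filter, Finset.mem_univ, true_and] at hj hj'
          simp only [b]
          rw [if_neg hj, if_neg (by omega)]
      rw [e1, hbW]
      apply max_le
      · apply Nat.mul_le_mul_left
        refine hJ.trans (Finset.sum_le_sum_of_subset ?_)
        intro j hj
        simp only [Finset.mem_filter, Finset.mem_univ, true_and] at hj ⊢
        omega
      · rw [← Finset.mul_sum]
        apply Nat.mul_le_mul_left
        refine Finset.sum_le_sum_of_subset ?_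
        intro j hj
        simp only [hW, Finset.mem_filter, Finset.mem_univ, true_and] at hj ⊢
        omega

end comb

lemma waldschmidt_main (K : Type*) [Field K] (n p r : ℕ) (A : Finset ℕ)
    (hA : ∀ x ∈ A, 1 ≤ x ∧ x < p) (hp : 1 ≤ p) (hn : p + r ≤ n) :
    waldschmidt (sfBorel K n (insert p A)) = waldschmidt (sfBorel K n (insert (p + r) A)) := by
  have hA1 : ∀ x ∈ insert p A, 1 ≤ x ∧ x ≤ n := by
    intro x hx
    rcases Finset.mem_insert.1 hx with rfl | hx
    · omega
    · have := hA x hx; omega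
  have hA2 : ∀ x ∈ insert (p + r) A, 1 ≤ x ∧ x ≤ n := by
    intro x hx
    rcases Finset.mem_insert.1 hx with rfl | hx
    · omega
    · have := hA x hx; omega
  have hpA : p ∉ A := fun h => by have := hA p h; omega
  have hprA : p + r ∉ A := fun h => by have := hA _ h; omega
  have hup : A.card < p := by
    have h1 : A ⊆ Finset.Ico 1 p := fun x hx => Finset.mem_Ico.2 (hA x hx)
    have h2 := Finset.card_le_card h1
    rw [Nat.card_Ico] at h2
    omega
  have hbdd : ∀ I : Ideal (MvPolynomial (Fin n) K), BddBelow (Set.range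
      (fun s : ℕ+ => (alpha (symbPow I (s : ℕ)) : ℝ) / ((s : ℕ) : ℝ))) := by
    intro I
    refine ⟨0, ?_⟩
    rintro _ ⟨s, rfl⟩
    positivity
  have hmem : ∀ B : Finset ℕ, (∀ x ∈ B, 1 ≤ x ∧ x ≤ n) → ∀ m,
      ∃ a : Fin n → ℕ, Feas B a m ∧ ∑ j, a j = alpha (symbPow (sfBorel K n B) m) := by
    intro B hB m
    rw [alpha_eq hB]
    exact Nat.sInf_mem (s := {d | ∃ a : Fin n → ℕ, Feas B a m ∧ ∑ j, a j = d})
      ⟨_, _, feas_const hB m, rfl⟩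
  have hle : ∀ B : Finset ℕ, (∀ x ∈ B, 1 ≤ x ∧ x ≤ n) → ∀ m (a : Fin n → ℕ), Feas B a m →
      alpha (symbPow (sfBorel K n B) m) ≤ ∑ j, a j := by
    intro B hB m a ha
    rw [alpha_eq hB]
    exact Nat.sInf_le ⟨a, ha, rfl⟩
  apply le_antisymm
  · refine le_ciInf (fun s => ?_)
    obtain ⟨a, ha, hsum⟩ := hmem _ hA2 s
    obtain ⟨a', ha', hsum', hmono⟩ := ha.sort
    obtain ⟨b, hb, hbs⟩ := feas_main hA hp hn ha' hmono
    have hLpos : 0 < p - A.card := by omega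
    refine (ciInf_le (hbdd _) (Nat.toPNat (p - A.card) hLpos * s)).trans ?_
    have h1 := (hle _ hA1 _ b hb).trans hbs
    rw [hsum', hsum] at h1
    have hs : (0 : ℝ) < ((s : ℕ) : ℝ) := by exact_mod_cast s.pos
    have hL : (0 : ℝ) < ((p - A.card : ℕ) : ℝ) := by exact_mod_cast hLpos
    have h2 : (alpha (symbPow (sfBorel K n (insert p A)) ((p - A.card) * (s : ℕ))) : ℝ) ≤
        ((p - A.card : ℕ) : ℝ) * (alpha (symbPow (sfBorel K n (insert (p + r) A)) (s : ℕ)) : ℝ) := by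
      exact_mod_cast h1
    have hc : ((Nat.toPNat (p - A.card) hLpos : ℕ+) : ℕ) = p - A.card := rfl
    rw [PNat.mul_coe, hc, Nat.cast_mul, div_le_div_iff₀ (by positivity) hs]
    nlinarith
  · refine le_ciInf (fun s => (ciInf_le (hbdd _) s).trans ?_)
    obtain ⟨a, ha, hsum⟩ := hmem _ hA1 s
    have h1 : Feas (insert (p + r) A) a s := by
      intro C t hC
      apply ha C t
      rw [cnt_insert hprA] at hC
      rw [cnt_insert hpA]
      split_ifs at hC ⊢ <;> omega
    have h2 := hle _ hA2 _ a h1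
    rw [hsum] at h2
    gcongr

end SFB

open SFB in
/-- Theorem 4.6: replacing the largest variable `x_{i_s}` of `m` by
`x_{i_s + r}` does not change the Waldschmidt constant. -/
theorem statement10 (K : Type*) [Field K] (n s r : ℕ) (i : ℕ → ℕ)
    (hs : 1 ≤ s)
    (hmono : ∀ q, 1 ≤ q → q < s → i q < i (q + 1))
    (h1 : 1 ≤ i 1) (hn : i s + r ≤ n) :
    waldschmidt (sfBorel K n ((Finset.Icc 1 s).image i)) =
      waldschmidt (sfBorel K n
        (insert (i s + r) ((Finset.Icc 1 (s - 1)).image i))) := by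
  have hlt : ∀ k q, 1 ≤ q → q + k + 1 ≤ s → i q < i (q + k + 1) := by
    intro k
    induction k with
    | zero => intro q h h'; exact hmono q h (by omega)
    | succ k ih =>
      intro q h h'
      have e1 := ih q h (by omega)
      have e2 := hmono (q + k + 1) (by omega) (by omega)
      exact e1.trans e2
  have hlt' : ∀ q q', 1 ≤ q → q < q' → q' ≤ s → i q < i q' := by
    intro q q' h1 h2 h3
    have := hlt (q' - q - 1) q h1 (by omega)
    rwa [show q + (q' - q - 1) + 1 = q' by omega] at this
  have hpos : ∀ q, 1 ≤ q → q ≤ s → 1 ≤ i q := by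
    intro q h h'
    rcases h.lt_or_eq with h2 | rfl
    · have := hlt' 1 q le_rfl h2 h'; omega
    · exact h1
  have hset : (Finset.Icc 1 s).image i = insert (i s) ((Finset.Icc 1 (s - 1)).image i) := by
    rw [← Finset.image_insert]
    congr 1
    ext x
    simp only [Finset.mem_insert, Finset.mem_Icc]
    omega
  rw [hset]
  apply waldschmidt_main K n (i s) r _ _ (hpos s hs le_rfl) hn
  intro x hx
  simp only [Finset.mem_image, Finset.mem_Icc] at hx
  obtain ⟨q, hq, rfl⟩ := hx
  exact ⟨hpos q hq.1 (by omega), hlt' q s hq.1 (by omega) le_rfl⟩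
end

section
/- Let i_1 < i_2 < ⋯ < i_s be positive integers with i_s + 1 ≤ n, and in S = K[x_1,…,x_n] let I = sfBorel(x_{i_1}⋯x_{i_{s−1}} x_{i_s}) and J = sfBorel(x_{i_1}⋯x_{i_{s−1}} x_{i_s + 1}). Then every minimal prime of J that is not a minimal prime of I contains both of the variables x_{i_s} and x_{i_s + 1}. -/
open MvPolynomial

namespace SFB

lemma sqfMon_mem_iff {K : Type*} [Field K] {n : ℕ} {P : Ideal (MvPolynomial (Fin n) K)}
    (hP : P.IsPrime) (B : Finset ℕ) :
    sqfMon K n B ∈ P ↔ ∃ j : Fin n, (j : ℕ) + 1 ∈ B ∧ (X j : MvPolynomial (Fin n) K) ∈ P := by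
  unfold sqfMon
  rw [hP.prod_mem_iff]
  constructor
  · rintro ⟨j, -, hj⟩
    by_cases h : (j : ℕ) + 1 ∈ B
    · exact ⟨j, h, by simpa [h] using hj⟩
    · rw [if_neg h] at hj
      exact absurd ((Ideal.eq_top_iff_one _).2 hj) hP.ne_top
  · rintro ⟨j, h, hj⟩
    exact ⟨j, Finset.mem_univ _, by simpa [h] using hj⟩

lemma sfBorel_le_iff {K : Type*} [Field K] {n : ℕ} {P : Ideal (MvPolynomial (Fin n) K)}
    (A : Finset ℕ) :
    sfBorel K n A ≤ P ↔ ∀ B, BorelReach A B → sqfMon K n B ∈ P := by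
  unfold sfBorel
  rw [Ideal.span_le]
  constructor
  · intro h B hB
    exact h ⟨B, hB, rfl⟩
  · rintro h f ⟨B, hB, rfl⟩
    exact h B hB

/-- Irredundancy of the variables in a minimal prime. -/
lemma exists_irredundant {K : Type*} [Field K] {n : ℕ} {P : Ideal (MvPolynomial (Fin n) K)}
    {A : Finset ℕ} (hP : P ∈ (sfBorel K n A).minimalPrimes) (b : Fin n)
    (hb : (X b : MvPolynomial (Fin n) K) ∈ P) :
    ∃ B, BorelReach A B ∧ (b : ℕ) + 1 ∈ B ∧
      ∀ j : Fin n, (j : ℕ) + 1 ∈ B → (X j : MvPolynomial (Fin n) K) ∈ P → j = b := by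
  classical
  obtain ⟨⟨hprime, hle⟩, hmin⟩ := hP
  let φ : MvPolynomial (Fin n) K →ₐ[K] MvPolynomial (Fin n) K :=
    aeval (fun j => if (X j : MvPolynomial (Fin n) K) ∈ P ∧ j ≠ b then 0 else X j)
  have hker : (RingHom.ker φ).IsPrime := RingHom.ker_isPrime φ
  have hX : ∀ j, X j ∈ RingHom.ker φ ↔ ((X j : MvPolynomial (Fin n) K) ∈ P ∧ j ≠ b) := by
    intro j
    rw [RingHom.mem_ker]
    simp only [φ, aeval_X]
    split_ifs with h
    · simp [h]
    · simp only [h, iff_false]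
      exact X_ne_zero j
  have hcomp : (Ideal.Quotient.mkₐ K P).comp φ = Ideal.Quotient.mkₐ K P := by
    apply MvPolynomial.algHom_ext
    intro j
    simp only [φ, AlgHom.comp_apply, aeval_X]
    split_ifs with h
    · rw [map_zero]
      exact (Ideal.Quotient.eq_zero_iff_mem.2 h.1).symm
    · rfl
  have hkP : RingHom.ker φ ≤ P := by
    intro f hf
    have h := DFunLike.congr_fun hcomp f
    rw [AlgHom.comp_apply, (RingHom.mem_ker).1 hf, map_zero] at h
    exact Ideal.Quotient.eq_zero_iff_mem.1 h.symm
  have hnot : ¬ sfBorel K n A ≤ RingHom.ker φ := by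
    intro h
    have := hmin ⟨hker, h⟩ hkP hb
    exact ((hX b).1 this).2 rfl
  rw [sfBorel_le_iff] at hnot
  push Not at hnot
  obtain ⟨B, hB, hBk⟩ := hnot
  have huniq : ∀ j : Fin n, (j : ℕ) + 1 ∈ B → (X j : MvPolynomial (Fin n) K) ∈ P → j = b := by
    intro j hj hjP
    by_contra hne
    exact hBk ((sqfMon_mem_iff hker B).2 ⟨j, hj, (hX j).2 ⟨hjP, hne⟩⟩)
  refine ⟨B, hB, ?_, huniq⟩
  obtain ⟨j, hj, hjP⟩ := (sqfMon_mem_iff hprime B).1 ((sfBorel_le_iff A).1 hle B hB)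
  rw [← huniq j hj hjP]
  exact hj

lemma reach_lt {L B : Finset ℕ} {m : ℕ} (hL : ∀ x ∈ L, x < m) (h : BorelReach L B) :
    ∀ x ∈ B, x < m := by
  induction h with
  | refl => exact hL
  | tail _ hm ih =>
    obtain ⟨a, ha, j, h1, h2, h3, rfl⟩ := hm
    intro x hx
    rw [Finset.mem_insert, Finset.mem_erase] at hx
    rcases hx with rfl | hx
    · exact h2.trans (ih a ha)
    · exact ih x hx.2

lemma reach_decomp {L B : Finset ℕ} {M : ℕ} (hM : 1 ≤ M) (hL : M ∉ L)
    (h : BorelReach (insert M L) B) :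
    ∃ B' t, BorelReach L B' ∧ t ∉ B' ∧ 1 ≤ t ∧ t ≤ M ∧ B = insert t B' := by
  induction h with
  | refl => exact ⟨L, M, Relation.ReflTransGen.refl, hL, hM, le_rfl, rfl⟩
  | tail _ hm ih =>
    obtain ⟨a, ha, j, h1, h2, h3, rfl⟩ := hm
    obtain ⟨B', t, hr, ht, ht1, htM, rfl⟩ := ih
    rw [Finset.mem_insert, not_or] at h3
    by_cases hat : a = t
    · subst hat
      exact ⟨B', j, hr, h3.2, h1, by omega, by rw [Finset.erase_insert ht]⟩
    · have ha' : a ∈ B' := by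
        rcases Finset.mem_insert.1 ha with h | h
        · exact absurd h hat
        · exact h
      refine ⟨insert j (B'.erase a), t,
        Relation.ReflTransGen.tail hr ⟨a, ha', j, h1, h2, h3.2, rfl⟩, ?_, ht1, htM, ?_⟩
      · simp only [Finset.mem_insert, Finset.mem_erase, not_or, not_and]
        exact ⟨fun h => h3.1 h.symm, fun _ => ht⟩
      · ext x
        simp only [Finset.mem_insert, Finset.mem_erase]
        constructor
        · tauto
        · rintro (rfl | h | h)
          · exact Or.inr ⟨fun h => hat h.symm, Or.inl rfl⟩
          · exact Or.inl h
          · exact Or.inr ⟨h.1, Or.inr h.2⟩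

lemma reach_insert {L B' : Finset ℕ} {M t : ℕ} (hL : ∀ x ∈ L, x < M)
    (h : BorelReach L B') (ht : t ∉ B') (h1 : 1 ≤ t) (htM : t ≤ M) :
    BorelReach (insert M L) (insert t B') := by
  have key : BorelReach (insert M L) (insert M B') := by
    clear ht
    induction h with
    | refl => exact Relation.ReflTransGen.refl
    | tail hr hm ih =>
      have hlt := reach_lt hL hr
      obtain ⟨a, ha, j, h1, h2, h3, rfl⟩ := hm
      have haM := hlt a ha
      refine Relation.ReflTransGen.tail ih
        ⟨a, Finset.mem_insert_of_mem ha, j, h1, h2, ?_, ?_⟩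
      · rw [Finset.mem_insert, not_or]
        exact ⟨by omega, h3⟩
      · rw [Finset.erase_insert_of_ne (by omega), Finset.insert_comm]
  have hlt := reach_lt hL h
  rcases htM.eq_or_lt with rfl | hlt'
  · exact key
  · have hMB : M ∉ B' := fun h => lt_irrefl _ (hlt M h)
    refine Relation.ReflTransGen.tail key ⟨M, Finset.mem_insert_self _ _, t, h1, hlt', ?_, ?_⟩
    · rw [Finset.mem_insert, not_or]
      exact ⟨by omega, ht⟩
    · rw [Finset.erase_insert hMB]

lemma core {K : Type*} [Field K] {n m : ℕ} {L : Finset ℕ} (hL : ∀ x ∈ L, x < m)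
    (hm : 1 ≤ m) (hn : m + 1 ≤ n) {P : Ideal (MvPolynomial (Fin n) K)}
    (hP : P ∈ (sfBorel K n (insert (m + 1) L)).minimalPrimes)
    (hPI : P ∉ (sfBorel K n (insert m L)).minimalPrimes) :
    X (⟨m - 1, by omega⟩ : Fin n) ∈ P ∧ X (⟨m, by omega⟩ : Fin n) ∈ P := by
  have hL' : ∀ x ∈ L, x < m + 1 := fun x hx => (hL x hx).trans (Nat.lt_succ_self m)
  have hmL : m ∉ L := fun h => lt_irrefl _ (hL m h)
  have hmL' : m + 1 ∉ L := fun h => lt_irrefl _ (hL' _ h)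
  have hprime := hP.1.1
  have hJ := (sfBorel_le_iff _).1 hP.1.2
  by_cases hX : (X (⟨m, by omega⟩ : Fin n) : MvPolynomial (Fin n) K) ∈ P
  · refine ⟨?_, hX⟩
    obtain ⟨B, hB, hbB, huniq⟩ := exists_irredundant hP _ hX
    obtain ⟨B', t, hr, ht, ht1, htM, rfl⟩ := reach_decomp (by omega) hmL' hB
    have hlt := reach_lt hL hr
    have hmB : m ∉ B' := fun h => lt_irrefl _ (hlt m h)
    obtain ⟨j, hj, hjP⟩ := (sqfMon_mem_iff hprime _).1
      (hJ _ (reach_insert hL' hr hmB hm (Nat.le_succ m)))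
    rcases Finset.mem_insert.1 hj with h | h
    · have : j = ⟨m - 1, by omega⟩ := Fin.ext (by simp only; omega)
      rwa [← this]
    · have h2 := huniq j (Finset.mem_insert_of_mem h) hjP
      have h3 := hlt _ h
      rw [h2] at h3
      simp only at h3
      omega
  · exfalso
    have hY : (X (⟨m - 1, by omega⟩ : Fin n) : MvPolynomial (Fin n) K) ∉ P := by
      intro hY
      obtain ⟨B, hB, hbB, huniq⟩ := exists_irredundant hP _ hY
      obtain ⟨B', t, hr, ht, ht1, htM, rfl⟩ := reach_decomp (by omega) hmL' hB
      have hlt := reach_lt hL hr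
      have hmB : m + 1 ∉ B' := fun h => by have := hlt _ h; omega
      obtain ⟨j, hj, hjP⟩ := (sqfMon_mem_iff hprime _).1
        (hJ _ (reach_insert hL' hr hmB (by omega) le_rfl))
      rcases Finset.mem_insert.1 hj with h | h
      · have : j = ⟨m, by omega⟩ := Fin.ext (by simp only; omega)
        rw [this] at hjP
        exact hX hjP
      · have h2 := huniq j (Finset.mem_insert_of_mem h) hjP
        have h3 := hlt _ h
        rw [h2] at h3
        simp only at h3
        omega
    apply hPI
    refine ⟨⟨hprime, ?_⟩, ?_⟩
    · rw [sfBorel_le_iff]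
      intro B hB
      obtain ⟨B', t, hr, ht, ht1, htM, rfl⟩ := reach_decomp hm hmL hB
      exact hJ _ (reach_insert hL' hr ht ht1 (by omega))
    · rintro Q ⟨hQ, hIQ⟩ hQP
      refine hP.2 ⟨hQ, ?_⟩ hQP
      rw [sfBorel_le_iff] at hIQ ⊢
      intro B hB
      obtain ⟨B', t, hr, ht, ht1, htM, rfl⟩ := reach_decomp (by omega) hmL' hB
      by_cases htm : t ≤ m
      · exact hIQ _ (reach_insert hL hr ht ht1 htm)
      · have hlt := reach_lt hL hr
        have hmB : m ∉ B' := fun h => lt_irrefl _ (hlt m h)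
        obtain ⟨j, hj, hjQ⟩ := (sqfMon_mem_iff hQ _).1
          (hIQ _ (reach_insert hL hr hmB hm le_rfl))
        rcases Finset.mem_insert.1 hj with h | h
        · have : j = ⟨m - 1, by omega⟩ := Fin.ext (by simp only; omega)
          rw [this] at hjQ
          exact absurd (hQP hjQ) hY
        · exact (sqfMon_mem_iff hQ _).2 ⟨j, Finset.mem_insert_of_mem h, hjQ⟩

end SFB

open SFB in
/-- Any minimal prime of `J = sfBorel(x_{i_1}⋯x_{i_{s-1}} x_{i_s + 1})` that is
not a minimal prime of `I = sfBorel(x_{i_1}⋯x_{i_{s-1}} x_{i_s})` contains both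
variables `x_{i_s}` and `x_{i_s + 1}`. -/
theorem statement12 (K : Type*) [Field K] (n s : ℕ) (i : ℕ → ℕ)
    (hs : 1 ≤ s)
    (hmono : ∀ q, 1 ≤ q → q < s → i q < i (q + 1))
    (h1 : 1 ≤ i 1) (hn : i s + 1 ≤ n)
    (P : Ideal (MvPolynomial (Fin n) K))
    (hP : P ∈ (sfBorel K n
      (insert (i s + 1) ((Finset.Icc 1 (s - 1)).image i))).minimalPrimes)
    (hPI : P ∉ (sfBorel K n ((Finset.Icc 1 s).image i)).minimalPrimes) :
    MvPolynomial.X (⟨i s - 1, by omega⟩ : Fin n) ∈ P ∧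
      MvPolynomial.X (⟨i s, by omega⟩ : Fin n) ∈ P := by
  have hlt : ∀ r, r ≤ s → ∀ q, 1 ≤ q → q < r → i q < i r := by
    intro r
    induction r with
    | zero => intro _ q _ h; omega
    | succ r ih =>
      intro hr q hq hqr
      have h2 := hmono r (by omega) (by omega)
      rcases Nat.lt_succ_iff_lt_or_eq.1 hqr with h | rfl
      · exact (ih (by omega) q hq h).trans h2
      · exact h2
  have hm : 1 ≤ i s := by
    rcases hs.eq_or_lt with h | h
    · rw [← h]; exact h1
    · have := hlt s le_rfl 1 le_rfl h
      omega
  have hL : ∀ x ∈ (Finset.Icc 1 (s - 1)).image i, x < i s := by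
    intro x hx
    obtain ⟨q, hq, rfl⟩ := Finset.mem_image.1 hx
    rw [Finset.mem_Icc] at hq
    exact hlt s le_rfl q hq.1 (by omega)
  have hA : (Finset.Icc 1 s).image i = insert (i s) ((Finset.Icc 1 (s - 1)).image i) := by
    rw [← Finset.image_insert]
    congr 1
    ext x
    simp only [Finset.mem_insert, Finset.mem_Icc]
    omega
  rw [hA] at hPI
  exact core hL hm hn hP hPI
end

section
/- Let m = x_{i_1}⋯x_{i_s} be a square-free monomial with i_1 < ⋯ < i_s and T(m) = (t_0, t_1, …, t_k). Let 0 ≤ p ≤ k and let r be an integer with t_{p+1} < r ≤ t_p (with the convention t_{k+1} = 0). Then i_r − r = i_{t_p} − t_p; in particular, the square-free monomial x_r x_{r+1}⋯x_{i_r} can be obtained from x_{t_p} x_{t_p+1}⋯x_{i_{t_p}} by a sequence of Borel moves. -/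
open MvPolynomial

namespace SFB

theorem reach_shift (a b d : ℕ) (ha : 1 ≤ a) :
    BorelReach (Finset.Icc (a + d) (b + d)) (Finset.Icc a b) := by
  induction d with
  | zero => exact Relation.ReflTransGen.refl
  | succ d ih =>
    by_cases hab : a ≤ b
    · refine Relation.ReflTransGen.head ?_ ih
      refine ⟨b + (d + 1), by simp; omega, a + d, by omega, by omega, by simp, ?_⟩
      ext x
      simp only [Finset.mem_insert, Finset.mem_erase, Finset.mem_Icc]
      omega
    · have e : Finset.Icc (a + (d + 1)) (b + (d + 1)) = Finset.Icc (a + d) (b + d) := by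
        ext x
        simp only [Finset.mem_Icc]
        omega
      rw [e]
      exact ih

end SFB

open SFB in
/-- If `t_{p+1} < r ≤ t_p` (convention `t_{k+1} = 0`), then
`i_r - r = i_{t_p} - t_p`; in particular `x_r x_{r+1} ⋯ x_{i_r}` is obtained
from `x_{t_p} x_{t_p + 1} ⋯ x_{i_{t_p}}` by a sequence of Borel moves. -/
theorem statement13 (s k p r : ℕ) (i t : ℕ → ℕ)
    (hs : 1 ≤ s)
    (hmono : ∀ q, 1 ≤ q → q < s → i q < i (q + 1))
    (h1 : 1 ≤ i 1)
    (hT : IsTSeq s i t k)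
    (hp : p ≤ k)
    (hr1 : 1 ≤ r) (hr2 : r ≤ t p)
    (hr3 : p < k → t (p + 1) < r) :
    (i r : ℤ) - (r : ℤ) = (i (t p) : ℤ) - (t p : ℤ) ∧
      BorelReach (Finset.Icc (t p) (i (t p))) (Finset.Icc r (i r)) := by
  obtain ⟨h0, hj, hk⟩ := hT
  have hts : ∀ q, q ≤ k → t q ≤ s := by
    intro q
    induction q with
    | zero => intro _; omega
    | succ q ih =>
      intro hq
      have h2 := (hj (q + 1) (by omega) hq).2.1
      have h3 := ih (by omega)
      simp only [Nat.add_sub_cancel] at h2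
      omega
  have hps := hts p hp
  have hstep : ∀ q, r ≤ q → q < t p → i (q + 1) = i q + 1 := by
    intro q hq1 hq2
    have h2 := hmono q (by omega) (by omega)
    have h3 : ¬ (i q + 1 < i (q + 1)) := by
      rcases Nat.lt_or_ge p k with hpk | hpk
      · have h4 := (hj (p + 1) (by omega) (by omega)).2.2.2
        have h5 := hr3 hpk
        exact h4 q (by omega) (by simpa using hq2)
      · have : p = k := by omega
        subst this
        exact hk q (by omega) hq2
    omega
  have hd : ∀ d, r + d ≤ t p → i (r + d) = i r + d := by
    intro d
    induction d with
    | zero => intro _; rfl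
    | succ d ih =>
      intro h
      have h2 := ih (by omega)
      have h3 := hstep (r + d) (by omega) (by omega)
      rw [← Nat.add_assoc, h3, h2, Nat.add_assoc]
  obtain ⟨d, hd'⟩ := Nat.exists_eq_add_of_le hr2
  have h6 := hd d (by omega)
  rw [hd', h6]
  exact ⟨by push_cast; ring, reach_shift r (i r) d hr1⟩
end

section
/- Let m = x_{i_1}⋯x_{i_s} be a square-free monomial in S = K[x_1,…,x_n] with i_1 < ⋯ < i_s ≤ n, T(m) = (t_0,…,t_k), IT(m) = (i_{t_0},…,i_{t_k}), and let ℓ be the unique index with i_{t_{ℓ+1}} < t_0 ≤ i_{t_ℓ} (convention i_{t_{k+1}} = 0); assume ℓ < k. Let m_1 = x_{i_1}⋯x_{i_{t_{ℓ+1}}} be the product of the first t_{ℓ+1} variables dividing m. Then every minimal prime of sfBorel(m_1) ⊆ S is also a minimal prime of sfBorel(m) ⊆ S. -/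
open MvPolynomial

namespace SFB

/-- Numerical covering condition. -/
def Cov (A C : Finset ℕ) : Prop :=
  ∃ a ∈ A, a < (A ∩ Finset.Icc 1 a).card + (C ∩ Finset.Icc 1 a).card

lemma move_card {A B : Finset ℕ} (h : BorelMove A B) (N : ℕ) :
    (A ∩ Finset.Icc 1 N).card ≤ (B ∩ Finset.Icc 1 N).card := by
  obtain ⟨i, hi, j, hj1, hji, hjA, rfl⟩ := h
  by_cases hiN : i ≤ N
  · have e : insert j (A.erase i) ∩ Finset.Icc 1 N
        = insert j ((A ∩ Finset.Icc 1 N).erase i) := by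
      ext x
      simp only [Finset.mem_inter, Finset.mem_insert, Finset.mem_erase, Finset.mem_Icc]
      constructor
      · tauto
      · rintro (rfl | h)
        · exact ⟨Or.inl rfl, hj1, by omega⟩
        · tauto
    rw [e, Finset.card_insert_of_notMem (by simp [hjA])]
    have := Finset.pred_card_le_card_erase (s := A ∩ Finset.Icc 1 N) (a := i)
    omega
  · apply Finset.card_le_card
    intro x
    simp only [Finset.mem_inter, Finset.mem_insert, Finset.mem_erase, Finset.mem_Icc]
    rintro ⟨h1, h2, h3⟩
    exact ⟨Or.inr ⟨by omega, h1⟩, h2, h3⟩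

lemma reach_card {A B : Finset ℕ} (h : BorelReach A B) (N : ℕ) :
    (A ∩ Finset.Icc 1 N).card ≤ (B ∩ Finset.Icc 1 N).card := by
  induction h with
  | refl => exact le_rfl
  | tail _ h ih => exact ih.trans (move_card h N)

lemma cov_meets {A B C : Finset ℕ} (hc : Cov A C) (h : BorelReach A B) :
    ∃ x, x ∈ B ∧ x ∈ C := by
  obtain ⟨a, -, hlt⟩ := hc
  have h1 := reach_card h a
  by_contra hne
  push Not at hne
  have hd : Disjoint (B ∩ Finset.Icc 1 a) (C ∩ Finset.Icc 1 a) := by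
    rw [Finset.disjoint_left]
    intro x hx hx'
    exact hne x (Finset.mem_inter.1 hx).1 (Finset.mem_inter.1 hx').1
  have h2 := Finset.card_union_of_disjoint hd
  have h3 : (B ∩ Finset.Icc 1 a ∪ C ∩ Finset.Icc 1 a).card ≤ (Finset.Icc 1 a).card :=
    Finset.card_le_card (Finset.union_subset Finset.inter_subset_right Finset.inter_subset_right)
  simp only [Nat.card_Icc] at h3
  omega

lemma exists_reach (D : Finset ℕ) : ∀ (N : ℕ) (A : Finset ℕ), (A \ D).card = N →
    (∀ a ∈ A, 1 ≤ a) →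
    (∀ a ∈ A, (A ∩ Finset.Icc 1 a).card ≤ (D ∩ Finset.Icc 1 a).card) →
    ∃ B, BorelReach A B ∧ B ⊆ D := by
  intro N
  induction N with
  | zero =>
    intro A h _ _
    exact ⟨A, Relation.ReflTransGen.refl, by
      rw [Finset.card_eq_zero, Finset.sdiff_eq_empty_iff_subset] at h; exact h⟩
  | succ N ih =>
    intro A h hpos hA
    have hne : (A \ D).Nonempty := by rw [← Finset.card_pos]; omega
    obtain ⟨a, haAD, hmin⟩ := Finset.exists_min_image (A \ D) id hne
    simp only [id] at hmin
    obtain ⟨haA, haD⟩ := Finset.mem_sdiff.1 haAD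
    have ha1 := hpos a haA
    have hex : ∃ d ∈ D ∩ Finset.Icc 1 a, d ∉ A := by
      by_contra hcon
      push Not at hcon
      have hss : D ∩ Finset.Icc 1 a ⊂ A ∩ Finset.Icc 1 a := by
        refine Finset.ssubset_iff_subset_ne.2 ⟨fun x hx =>
          Finset.mem_inter.2 ⟨hcon x hx, (Finset.mem_inter.1 hx).2⟩, fun e => ?_⟩
        have : a ∈ A ∩ Finset.Icc 1 a := by simp [haA, ha1]
        rw [← e] at this
        exact haD (Finset.mem_inter.1 this).1
      have := Finset.card_lt_card hss
      have := hA a haA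
      omega
    obtain ⟨d, hd, hdA⟩ := hex
    simp only [Finset.mem_inter, Finset.mem_Icc] at hd
    obtain ⟨hdD, hd1, hda⟩ := hd
    have hda' : d < a := lt_of_le_of_ne hda (fun e => hdA (e ▸ haA))
    have hmove : BorelMove A (insert d (A.erase a)) := ⟨a, haA, d, hd1, hda', hdA, rfl⟩
    obtain ⟨B, hB, hBD⟩ := ih (insert d (A.erase a)) (by
        have e : insert d (A.erase a) \ D = (A \ D).erase a := by
          ext x
          simp only [Finset.mem_sdiff, Finset.mem_insert, Finset.mem_erase]
          constructor
          · rintro ⟨rfl | h, h'⟩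
            · exact absurd hdD h'
            · tauto
          · tauto
        rw [e, Finset.card_erase_of_mem haAD]; omega)
      (by
        intro x hx
        rcases Finset.mem_insert.1 hx with rfl | hx
        · exact hd1
        · exact hpos x (Finset.mem_of_mem_erase hx))
      (by
        intro x hx
        by_cases hxa : x < a
        · apply Finset.card_le_card
          intro y hy
          simp only [Finset.mem_inter, Finset.mem_insert, Finset.mem_erase,
            Finset.mem_Icc] at hy ⊢
          refine ⟨?_, hy.2⟩
          rcases hy.1 with rfl | ⟨_, hyA⟩
          · exact hdD
          · by_contra hyD
            have := hmin y (Finset.mem_sdiff.2 ⟨hyA, hyD⟩)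
            omega
        · have hxA : x ∈ A := by
            rcases Finset.mem_insert.1 hx with rfl | hx
            · omega
            · exact Finset.mem_of_mem_erase hx
          refine le_trans ?_ (hA x hxA)
          have e : insert d (A.erase a) ∩ Finset.Icc 1 x
              ⊆ insert d ((A ∩ Finset.Icc 1 x).erase a) := by
            intro y
            simp only [Finset.mem_inter, Finset.mem_insert, Finset.mem_erase, Finset.mem_Icc]
            tauto
          refine (Finset.card_le_card e).trans ((Finset.card_insert_le _ _).trans ?_)
          have hm : a ∈ A ∩ Finset.Icc 1 x := by
            simp only [Finset.mem_inter, Finset.mem_Icc]; exact ⟨haA, ha1, by omega⟩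
          rw [Finset.card_erase_add_one hm])
    exact ⟨B, Relation.ReflTransGen.head hmove hB, hBD⟩

lemma not_cov {A C : Finset ℕ} {n : ℕ} (hAn : A ⊆ Finset.Icc 1 n) (hc : ¬ Cov A C) :
    ∃ B, BorelReach A B ∧ B ⊆ Finset.Icc 1 n \ C := by
  refine exists_reach _ _ A rfl (fun a ha => (Finset.mem_Icc.1 (hAn ha)).1) ?_
  intro a ha
  have h1 : ¬ _ := fun h => hc ⟨a, ha, h⟩
  have han := (Finset.mem_Icc.1 (hAn ha)).2
  have e : (Finset.Icc 1 n \ C) ∩ Finset.Icc 1 a = Finset.Icc 1 a \ (C ∩ Finset.Icc 1 a) := by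
    ext x
    simp only [Finset.mem_inter, Finset.mem_sdiff, Finset.mem_Icc]
    constructor
    · tauto
    · rintro ⟨h, h'⟩
      exact ⟨⟨⟨h.1, by omega⟩, by tauto⟩, h⟩
  rw [e, Finset.card_sdiff_of_subset Finset.inter_subset_right]
  simp only [Nat.card_Icc]
  omega

open Classical in
/-- The (1-based) variables in `P`. -/
noncomputable def vars' {K : Type*} [Field K] {n : ℕ}
    (P : Ideal (MvPolynomial (Fin n) K)) : Finset ℕ :=
  (Finset.univ.filter (fun j : Fin n => (X j : MvPolynomial (Fin n) K) ∈ P)).image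
    (fun j => (j : ℕ) + 1)

lemma mem_vars {K : Type*} [Field K] {n : ℕ} (P : Ideal (MvPolynomial (Fin n) K)) (c : ℕ) :
    c ∈ vars' P ↔ ∃ j : Fin n, (X j : MvPolynomial (Fin n) K) ∈ P ∧ (j : ℕ) + 1 = c := by
  simp [vars']

lemma le_iff_cov {K : Type*} [Field K] {n : ℕ} (P : Ideal (MvPolynomial (Fin n) K))
    [hP : P.IsPrime] {A : Finset ℕ} (hAn : A ⊆ Finset.Icc 1 n) :
    sfBorel K n A ≤ P ↔ Cov A (vars' P) := by
  constructor
  · intro h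
    by_contra hc
    obtain ⟨B, hB, hBs⟩ := not_cov hAn hc
    have hm : sqfMon K n B ∈ P := h (Ideal.subset_span ⟨B, hB, rfl⟩)
    rw [sqfMon, hP.prod_mem_iff] at hm
    obtain ⟨j, -, hj⟩ := hm
    split_ifs at hj with hjB
    · exact (Finset.mem_sdiff.1 (hBs hjB)).2 ((mem_vars P _).2 ⟨j, hj, rfl⟩)
    · exact hP.ne_top ((Ideal.eq_top_iff_one _).2 hj)
  · intro hc
    rw [sfBorel, Ideal.span_le]
    rintro f ⟨B, hB, rfl⟩
    obtain ⟨x, hxB, hxC⟩ := cov_meets hc hB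
    obtain ⟨j, hj, rfl⟩ := (mem_vars P _).1 hxC
    rw [SetLike.mem_coe, sqfMon, hP.prod_mem_iff]
    exact ⟨j, Finset.mem_univ _, by rw [if_pos hxB]; exact hj⟩

lemma vars_mono {K : Type*} [Field K] {n : ℕ} {P Q : Ideal (MvPolynomial (Fin n) K)}
    (h : P ≤ Q) : vars' P ⊆ vars' Q := by
  intro c
  rw [mem_vars, mem_vars]
  rintro ⟨j, hj, e⟩
  exact ⟨j, h hj, e⟩

lemma exists_prime (K : Type*) [Field K] {n : ℕ} (C : Finset ℕ) (hC : C ⊆ Finset.Icc 1 n) :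
    ∃ P : Ideal (MvPolynomial (Fin n) K), P.IsPrime ∧ vars' P = C ∧
      ∀ Q : Ideal (MvPolynomial (Fin n) K), C ⊆ vars' Q → P ≤ Q := by
  classical
  let φ : MvPolynomial (Fin n) K →ₐ[K] MvPolynomial (Fin n) K :=
    aeval (fun j : Fin n => if (j : ℕ) + 1 ∈ C then 0 else X j)
  have hφ : ∀ j : Fin n, φ (X j) = if (j : ℕ) + 1 ∈ C then 0 else X j := fun j => by
    simp only [φ, aeval_X]
  refine ⟨RingHom.ker φ, RingHom.ker_isPrime φ, ?_, ?_⟩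
  · ext c
    rw [mem_vars]
    constructor
    · rintro ⟨j, hj, rfl⟩
      rw [RingHom.mem_ker, hφ] at hj
      by_contra h
      rw [if_neg h] at hj
      exact X_ne_zero j hj
    · intro hc
      have := Finset.mem_Icc.1 (hC hc)
      have e : c - 1 + 1 = c := by omega
      refine ⟨⟨c - 1, by omega⟩, ?_, e⟩
      rw [RingHom.mem_ker, hφ, if_pos]
      simpa only [e] using hc
  · intro Q hQ f hf
    have key : (Ideal.Quotient.mkₐ K Q).comp φ = Ideal.Quotient.mkₐ K Q := by
      apply MvPolynomial.algHom_ext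
      intro j
      rw [AlgHom.comp_apply, hφ]
      split_ifs with hj
      · obtain ⟨j', hj', e⟩ := (mem_vars Q _).1 (hQ hj)
        have : j' = j := Fin.ext (by omega)
        subst this
        rw [map_zero, Ideal.Quotient.mkₐ_eq_mk]
        exact (Ideal.Quotient.eq_zero_iff_mem.2 hj').symm
      · rfl
    have h := congrArg (fun g => g f) key
    simp only [AlgHom.comp_apply] at h
    rw [RingHom.mem_ker] at hf
    rw [hf, map_zero, Ideal.Quotient.mkₐ_eq_mk] at h
    exact Ideal.Quotient.eq_zero_iff_mem.1 h.symm

lemma main (K : Type*) [Field K] (n s p : ℕ) (i : ℕ → ℕ) (hp : 1 ≤ p) (hps : p ≤ s)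
    (hmono : ∀ r, 1 ≤ r → r < s → i r < i (r + 1)) (h1 : 1 ≤ i 1) (hn : i s ≤ n) :
    (sfBorel K n ((Finset.Icc 1 p).image i)).minimalPrimes ⊆
      (sfBorel K n ((Finset.Icc 1 s).image i)).minimalPrimes := by
  -- growth of `i`
  have hgrow : ∀ d a, 1 ≤ a → a + d ≤ s → i a + d ≤ i (a + d) := by
    intro d
    induction d with
    | zero => intro a _ _; simp
    | succ d ih =>
      intro a ha hd
      have := ih a ha (by omega)
      have := hmono (a + d) (by omega) (by omega)
      rw [← add_assoc a d 1]
      omega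
  have hg : ∀ a b, 1 ≤ a → a ≤ b → b ≤ s → i a + (b - a) ≤ i b := by
    intro a b ha hab hb
    have := hgrow (b - a) a ha (by omega)
    rwa [Nat.add_sub_cancel' hab] at this
  have hsub : ∀ q, 1 ≤ q → q ≤ s → (Finset.Icc 1 q).image i ⊆ Finset.Icc 1 n := by
    intro q hq hqs x hx
    obtain ⟨r, hr, rfl⟩ := Finset.mem_image.1 hx
    rw [Finset.mem_Icc] at hr ⊢
    have := hg 1 r le_rfl hr.1 (by omega)
    have := hg r s hr.1 (by omega) le_rfl
    omega
  have hcard : ∀ q r, 1 ≤ r → r ≤ q → q ≤ s →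
      ((Finset.Icc 1 q).image i ∩ Finset.Icc 1 (i r)).card = r := by
    intro q r hr hrq hqs
    have e : (Finset.Icc 1 q).image i ∩ Finset.Icc 1 (i r) = (Finset.Icc 1 r).image i := by
      ext x
      simp only [Finset.mem_inter, Finset.mem_image, Finset.mem_Icc]
      constructor
      · rintro ⟨⟨a, ha, rfl⟩, hx⟩
        refine ⟨a, ⟨ha.1, ?_⟩, rfl⟩
        by_contra hlt
        have := hg r a hr (by omega) (by omega)
        omega
      · rintro ⟨a, ha, rfl⟩
        have := hg 1 a le_rfl ha.1 (by omega)
        have := hg a r ha.1 ha.2 (by omega)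
        exact ⟨⟨a, ⟨ha.1, by omega⟩, rfl⟩, by omega, by omega⟩
    rw [e, Finset.card_image_of_injOn]
    · simp
    · intro a ha b hb hab
      simp only [Finset.coe_Icc, Set.mem_Icc] at ha hb
      rcases lt_trichotomy a b with h | h | h
      · have := hg a b ha.1 h.le (by omega)
        omega
      · exact h
      · have := hg b a hb.1 h.le (by omega)
        omega
  have hcov : ∀ q C, q ≤ s → (Cov ((Finset.Icc 1 q).image i) C ↔
      ∃ r, 1 ≤ r ∧ r ≤ q ∧ i r < r + (C ∩ Finset.Icc 1 (i r)).card) := by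
    intro q C hq
    constructor
    · rintro ⟨a, ha, h⟩
      obtain ⟨r, hr, rfl⟩ := Finset.mem_image.1 ha
      rw [Finset.mem_Icc] at hr
      rw [hcard q r hr.1 hr.2 hq] at h
      exact ⟨r, hr.1, hr.2, h⟩
    · rintro ⟨r, hr1, hr2, h⟩
      refine ⟨i r, Finset.mem_image.2 ⟨r, Finset.mem_Icc.2 ⟨hr1, hr2⟩, rfl⟩, ?_⟩
      rw [hcard q r hr1 hr2 hq]
      exact h
  intro Q hQ
  obtain ⟨⟨hQp, hQle⟩, hQmin⟩ := hQ
  haveI := hQp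
  have hcQ := (le_iff_cov Q (hsub p hp hps)).1 hQle
  rw [hcov p _ hps] at hcQ
  obtain ⟨q, hq1, hqp, hq⟩ := hcQ
  -- the variable set of `Q` is small
  have hiq : q ≤ i q := by have := hg 1 q le_rfl hq1 (by omega); omega
  have hsmall : (vars' Q).card ≤ i q - q + 1 := by
    obtain ⟨C0, hC0, hC0c⟩ := Finset.exists_subset_card_eq
      (show i q - q + 1 ≤ (vars' Q ∩ Finset.Icc 1 (i q)).card by omega)
    have hin : i q ≤ n := by have := hg q s hq1 (by omega) le_rfl; omega
    obtain ⟨P, hP, hPv, hPle⟩ := exists_prime K (n := n) C0 (fun x hx => by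
      have := Finset.mem_Icc.1 (Finset.mem_inter.1 (hC0 hx)).2
      exact Finset.mem_Icc.2 ⟨this.1, by omega⟩)
    have hPQ : P ≤ Q := hPle Q (fun x hx => (Finset.mem_inter.1 (hC0 hx)).1)
    have hIP : sfBorel K n ((Finset.Icc 1 p).image i) ≤ P := by
      rw [le_iff_cov P (hsub p hp hps), hcov p _ hps, hPv]
      refine ⟨q, hq1, hqp, ?_⟩
      rw [Finset.inter_eq_left.2 (fun x hx => (Finset.mem_inter.1 (hC0 hx)).2), hC0c]
      omega
    have := vars_mono (hQmin ⟨hP, hIP⟩ hPQ)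
    rw [hPv] at this
    rw [← hC0c]
    exact Finset.card_le_card this
  refine ⟨⟨hQp, ?_⟩, ?_⟩
  · rw [le_iff_cov Q (hsub s (by omega) le_rfl), hcov s _ le_rfl]
    exact ⟨q, hq1, by omega, hq⟩
  · rintro Q' ⟨hQ'p, hQ'le⟩ hQ'Q
    haveI := hQ'p
    refine hQmin ⟨hQ'p, ?_⟩ hQ'Q
    rw [le_iff_cov Q' (hsub p hp hps), hcov p _ hps]
    rw [le_iff_cov Q' (hsub s (by omega) le_rfl), hcov s _ le_rfl] at hQ'le
    obtain ⟨r, hr1, hrs, hr⟩ := hQ'le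
    by_cases hrp : r ≤ p
    · exact ⟨r, hr1, hrp, hr⟩
    · have hle := Finset.card_le_card
        (Finset.inter_subset_left (s₁ := vars' Q') (s₂ := Finset.Icc 1 (i r)))
      have h2 := hg q r hq1 (by omega) hrs
      have e : vars' Q' = vars' Q := Finset.eq_of_subset_of_card_le (vars_mono hQ'Q) (by omega)
      exact ⟨q, hq1, hqp, by rw [e]; exact hq⟩

end SFB

open SFB in
/-- Every minimal prime of `sfBorel(m₁)` (with `m₁ = x_{i_1}⋯x_{i_{t_{ℓ+1}}}`)
is also a minimal prime of `sfBorel(m)`, both ideals taken in `K[x_1,…,x_n]`. -/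
theorem statement14 (K : Type*) [Field K] (n s k ℓ : ℕ) (i t : ℕ → ℕ)
    (hs : 1 ≤ s)
    (hmono : ∀ r, 1 ≤ r → r < s → i r < i (r + 1))
    (h1 : 1 ≤ i 1) (hn : i s ≤ n)
    (hT : IsTSeq s i t k)
    (hℓk : ℓ < k)
    (hℓ1 : t 0 ≤ i (t ℓ))
    (hℓ2 : i (t (ℓ + 1)) < t 0) :
    (sfBorel K n ((Finset.Icc 1 (t (ℓ + 1))).image i)).minimalPrimes ⊆
      (sfBorel K n ((Finset.Icc 1 s).image i)).minimalPrimes := by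
  have hle : ∀ j, j ≤ k → t j ≤ s := by
    intro j
    induction j with
    | zero => intro _; exact hT.1.le
    | succ j ih =>
      intro hj
      have h2 := (hT.2.1 (j + 1) (by omega) hj).2.1
      have h3 := ih (by omega)
      simp only [Nat.add_sub_cancel] at h2
      omega
  exact main K n s (t (ℓ + 1)) i (hT.2.1 (ℓ + 1) (by omega) (by omega)).1
    (hle _ (by omega)) hmono h1 hn
end

section
/- Let m = x_{i_1}⋯x_{i_s} be a square-free monomial in S = K[x_1,…,x_n] with i_1 < ⋯ < i_s ≤ n, T(m) = (t_0,…,t_k), IT(m) = (i_{t_0},…,i_{t_k}), and let ℓ be the unique index with i_{t_{ℓ+1}} < t_0 ≤ i_{t_ℓ} (convention i_{t_{k+1}} = 0); assume ℓ < k and set ν = i_{t_{ℓ+1}} + 1. Let m_2 = x_{i_ν} x_{i_{ν+1}}⋯x_{i_{t_0}} (the product of the last t_0 − ν + 1 variables dividing m), and let J ⊆ S be the ideal generated by all square-free monomials obtainable from m_2 by finitely many Borel moves that only involve the variables x_ν, x_{ν+1}, …, x_n (that is, each move replaces some x_i dividing the monomial by some x_j with ν ≤ j < i). Then every minimal prime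 of J is also a minimal prime of sfBorel(m) ⊆ S. -/
open MvPolynomial

namespace SFB

/-- A Borel move that only involves the variables `x_ν, x_{ν+1}, …`:
some index `i ∈ A` is replaced by an index `j` with `ν ≤ j < i`, `j ∉ A`. -/
def BorelMoveFrom (ν : ℕ) (A B : Finset ℕ) : Prop :=
  ∃ i ∈ A, ∃ j, ν ≤ j ∧ j < i ∧ j ∉ A ∧ B = insert j (A.erase i)

/-- `B` is obtained from `A` by finitely many Borel moves only involving the
variables `x_ν, x_{ν+1}, …`. -/
def BorelReachFrom (ν : ℕ) (A B : Finset ℕ) : Prop :=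
  Relation.ReflTransGen (BorelMoveFrom ν) A B

end SFB

namespace SFB

theorem sqfMon_mem_of_mem {K : Type*} [Field K] {n : ℕ} {B : Finset ℕ}
    (P : Ideal (MvPolynomial (Fin n) K)) (hP : P.IsPrime) (h : sqfMon K n B ∈ P) :
    ∃ j : Fin n, (j : ℕ) + 1 ∈ B ∧ X j ∈ P := by
  unfold sqfMon at h
  rw [hP.prod_mem_iff] at h
  obtain ⟨j, -, hj⟩ := h
  by_cases hB : (j : ℕ) + 1 ∈ B
  · rw [if_pos hB] at hj
    exact ⟨j, hB, hj⟩
  · rw [if_neg hB] at hj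
    exact absurd ((Ideal.eq_top_iff_one _).2 hj) hP.ne_top

theorem X_dvd_sqfMon {K : Type*} [Field K] {n : ℕ} {B : Finset ℕ} (j : Fin n)
    (h : (j : ℕ) + 1 ∈ B) : (X j : MvPolynomial (Fin n) K) ∣ sqfMon K n B := by
  have := Finset.dvd_prod_of_mem
    (fun j : Fin n => if (j : ℕ) + 1 ∈ B then (X j : MvPolynomial (Fin n) K) else 1)
    (Finset.mem_univ j)
  simpa [h, sqfMon] using this

theorem sqfMon_dvd {K : Type*} [Field K] {n : ℕ} {B C : Finset ℕ} (h : B ⊆ C) :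
    sqfMon K n B ∣ sqfMon K n C := by
  unfold sqfMon
  apply Finset.prod_dvd_prod_of_dvd
  intro j _
  by_cases hB : (j : ℕ) + 1 ∈ B
  · rw [if_pos hB, if_pos (h hB)]
  · rw [if_neg hB]; exact one_dvd _

theorem reachFrom_ge {ν : ℕ} {A B : Finset ℕ} (h : BorelReachFrom ν A B)
    (hA : ∀ x ∈ A, ν ≤ x) : ∀ x ∈ B, ν ≤ x := by
  induction h with
  | refl => exact hA
  | tail _ hm ih =>
    obtain ⟨i, hi, j, hj, -, -, rfl⟩ := hm
    intro x hx
    simp only [Finset.mem_insert, Finset.mem_erase] at hx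
    rcases hx with rfl | ⟨-, hx⟩
    · exact hj
    · exact ih x hx

theorem reach_lift {ν : ℕ} (hν : 1 ≤ ν) {A B : Finset ℕ} (h : BorelReachFrom ν A B)
    (hA : ∀ x ∈ A, ν ≤ x) :
    BorelReach (Finset.Icc 1 (ν - 1) ∪ A) (Finset.Icc 1 (ν - 1) ∪ B) := by
  induction h with
  | refl => exact Relation.ReflTransGen.refl
  | tail h hm ih =>
    have hg := reachFrom_ge h hA
    refine Relation.ReflTransGen.tail ih ?_
    obtain ⟨i, hi, j, hj, hji, hjn, rfl⟩ := hm
    refine ⟨i, Finset.mem_union_right _ hi, j, by omega, hji, ?_, ?_⟩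
    · simp only [Finset.mem_union, Finset.mem_Icc, not_or]
      exact ⟨by omega, hjn⟩
    · ext x
      have := hg i hi
      simp only [Finset.mem_union, Finset.mem_Icc, Finset.mem_insert, Finset.mem_erase]
      constructor
      · rintro (h | h | h)
        · right; exact ⟨by omega, Or.inl h⟩
        · left; exact h
        · right; exact ⟨h.1, Or.inr h.2⟩
      · rintro (h | ⟨h, h' | h'⟩)
        · right; left; exact h
        · left; exact h'
        · right; right; exact ⟨h, h'⟩

theorem strict {s : ℕ} {i : ℕ → ℕ} (hmono : ∀ r, 1 ≤ r → r < s → i r < i (r + 1)) (a b : ℕ)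
    (ha : 1 ≤ a) (hab : a < b) (hb : b ≤ s) : i a < i b := by
  induction b, hab using Nat.le_induction with
  | base => exact hmono a ha (by omega)
  | succ b hab ih =>
    have := ih (by omega)
    have := hmono b (by omega) (by omega)
    omega

theorem self_le {s : ℕ} {i : ℕ → ℕ} (hmono : ∀ r, 1 ≤ r → r < s → i r < i (r + 1)) 
    (h1 : 1 ≤ i 1) (a : ℕ)
    (ha : 1 ≤ a) (hb : a ≤ s) : a ≤ i a := by
  induction a, ha using Nat.le_induction with
  | base => exact h1
  | succ b hab ih =>
    have := ih (by omega)
    have := hmono b (by omega) (by omega)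
    omega

theorem reach_start {s : ℕ} {i : ℕ → ℕ} (hmono : ∀ r, 1 ≤ r → r < s → i r < i (r + 1))
    (h1 : 1 ≤ i 1) (q : ℕ) (hq : q ≤ s) :
    BorelReach ((Finset.Icc 1 s).image i)
      (Finset.Icc 1 q ∪ (Finset.Icc (q + 1) s).image i) := by
  induction q with
  | zero =>
    have h0 : Finset.Icc 1 0 ∪ (Finset.Icc (0 + 1) s).image i = (Finset.Icc 1 s).image i := by
      simp
    rw [h0]
    exact Relation.ReflTransGen.refl
  | succ q ih =>
    have ih := ih (by omega)
    have hle := self_le hmono h1 (q + 1) (by omega) hq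
    have hst := fun b => strict hmono (q + 1) b (by omega)
    rcases hle.eq_or_lt with he | hlt
    · convert ih using 1
      ext x
      simp only [Finset.mem_union, Finset.mem_Icc, Finset.mem_image]
      constructor
      · rintro (h | ⟨a, ha, rfl⟩)
        · by_cases hx : x = q + 1
          · right; exact ⟨q + 1, by omega, by omega⟩
          · left; omega
        · right; exact ⟨a, by omega, rfl⟩
      · rintro (h | ⟨a, ha, rfl⟩)
        · left; omega
        · by_cases hx : a = q + 1
          · left; subst hx; omega
          · right; exact ⟨a, by omega, rfl⟩
    · refine Relation.ReflTransGen.tail ih ?_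
      refine ⟨i (q + 1), ?_, q + 1, by omega, hlt, ?_, ?_⟩
      · exact Finset.mem_union_right _ (Finset.mem_image_of_mem _ (by simp; omega))
      · simp only [Finset.mem_union, Finset.mem_Icc, Finset.mem_image, not_or]
        refine ⟨by omega, ?_⟩
        rintro ⟨a, ha, hh⟩
        by_cases hx : a = q + 1
        · subst hx; omega
        · have := hst a (by omega) (by omega)
          omega
      · ext x
        simp only [Finset.mem_union, Finset.mem_Icc, Finset.mem_image, Finset.mem_insert,
          Finset.mem_erase]
        constructor
        · rintro (h | ⟨a, ha, rfl⟩)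
          · by_cases hx : x = q + 1
            · left; exact hx
            · right; exact ⟨by omega, Or.inl (by omega)⟩
          · right
            have := hst a (by omega) (by omega)
            exact ⟨by omega, Or.inr ⟨a, by omega, rfl⟩⟩
        · rintro (h | ⟨h, h' | ⟨a, ha, rfl⟩⟩)
          · left; omega
          · left; omega
          · right
            refine ⟨a, ⟨?_, ha.2⟩, rfl⟩
            by_contra hc
            exact h (by rw [show a = q + 1 by omega])

theorem reach_top {ν : ℕ} (hν : 1 ≤ ν) {D₀ T₀ B : Finset ℕ} (h : BorelReach (D₀ ∪ T₀) B)
    (hlt : ∀ x ∈ D₀, ∀ y ∈ T₀, x < y) (hpos : ∀ x ∈ D₀ ∪ T₀, 1 ≤ x)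
    (hcard : D₀.card = ν - 1) :
    ∃ D T, B = D ∪ T ∧ (∀ x ∈ D, ∀ y ∈ T, x < y) ∧ (∀ x ∈ B, 1 ≤ x) ∧ D.card = ν - 1 ∧
      BorelReachFrom ν T₀ T := by
  induction h with
  | refl => exact ⟨D₀, T₀, rfl, hlt, hpos, hcard, Relation.ReflTransGen.refl⟩
  | tail _ hm ih =>
    obtain ⟨D, T, rfl, hlt, hpos, hcard, hr⟩ := ih
    obtain ⟨i, hi, j, hj, hji, hjn, rfl⟩ := hm
    have hpos' : ∀ x ∈ insert j ((D ∪ T).erase i), 1 ≤ x := by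
      intro x hx
      simp only [Finset.mem_insert, Finset.mem_erase] at hx
      rcases hx with rfl | ⟨-, hx⟩
      · exact hj
      · exact hpos x hx
    have hjD : j ∉ D := fun h => hjn (Finset.mem_union_left _ h)
    have hjT : j ∉ T := fun h => hjn (Finset.mem_union_right _ h)
    by_cases hiD : i ∈ D
    · refine ⟨insert j (D.erase i), T, ?_, ?_, hpos', ?_, hr⟩
      · have : i ∉ T := fun h => lt_irrefl _ (hlt i hiD i h)
        grind
      · intro x hx y hy
        have := hlt i hiD y hy
        grind
      · rw [Finset.card_insert_of_notMem (by grind), Finset.card_erase_of_mem hiD]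
        have := Finset.card_pos.2 ⟨i, hiD⟩
        omega
    · have hiT : i ∈ T := by grind
      by_cases hall : ∀ x ∈ D, x < j
      · refine ⟨D, insert j (T.erase i), by grind, by grind, hpos', hcard, ?_⟩
        refine hr.tail ⟨i, hiT, j, ?_, hji, hjT, rfl⟩
        have : D ⊆ Finset.Icc 1 (j - 1) := by
          intro x hx
          have := hall x hx
          have := hpos x (Finset.mem_union_left _ hx)
          rw [Finset.mem_Icc]; omega
        have := Finset.card_le_card this
        rw [Nat.card_Icc] at this
        omega
      · have hne : D.Nonempty := by
          by_contra hc
          rw [Finset.not_nonempty_iff_eq_empty] at hc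
          subst hc
          simp at hall
        obtain ⟨c, hc, hmax⟩ := D.exists_max_image id hne
        simp only [id] at hmax
        have hjc : j < c := by
          push Not at hall
          obtain ⟨x, hx, hjx⟩ := hall
          have := hmax x hx
          have : j ≠ c := by rintro rfl; exact hjD hc
          omega
        have hcT : c ∉ T := fun h => lt_irrefl _ (hlt c hc c h)
        refine ⟨insert j (D.erase c), insert c (T.erase i), by grind, ?_, hpos', ?_, ?_⟩
        · intro x hx y hy
          simp only [Finset.mem_insert, Finset.mem_erase] at hx hy
          rcases hx with rfl | ⟨hxc, hx⟩ <;> rcases hy with rfl | ⟨hyi, hy⟩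
          · exact hjc
          · exact hjc.trans (hlt c hc y hy)
          · exact lt_of_le_of_ne (hmax x hx) hxc
          · exact hlt x hx y hy
        · rw [Finset.card_insert_of_notMem (by grind), Finset.card_erase_of_mem hc]
          have := Finset.card_pos.2 ⟨c, hc⟩
          omega
        · refine hr.tail ⟨i, hiT, c, ?_, hlt c hc i hiT, hcT, rfl⟩
          have : insert j D ⊆ Finset.Icc 1 c := by
            intro x hx
            rw [Finset.mem_Icc]
            rcases Finset.mem_insert.1 hx with rfl | hx
            · omega
            · exact ⟨hpos x (Finset.mem_union_left _ hx), hmax x hx⟩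
          have := Finset.card_le_card this
          rw [Nat.card_Icc, Finset.card_insert_of_notMem hjD] at this
          omega

end SFB

open SFB in
/-- Every minimal prime of the ideal `J` generated by the square-free
monomials obtained from `m₂ = x_{i_ν} ⋯ x_{i_{t_0}}` by Borel moves involving
only the variables `x_ν, …, x_n` (where `ν = i_{t_{ℓ+1}} + 1`) is also a
minimal prime of `sfBorel(m)`. -/
theorem statement15 (K : Type*) [Field K] (n s k ℓ ν : ℕ) (i t : ℕ → ℕ)
    (hs : 1 ≤ s)
    (hmono : ∀ r, 1 ≤ r → r < s → i r < i (r + 1))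
    (h1 : 1 ≤ i 1) (hn : i s ≤ n)
    (hT : IsTSeq s i t k)
    (hℓk : ℓ < k)
    (hℓ1 : t 0 ≤ i (t ℓ))
    (hℓ2 : i (t (ℓ + 1)) < t 0)
    (hν : ν = i (t (ℓ + 1)) + 1) :
    (Ideal.span {f | ∃ B, BorelReachFrom ν ((Finset.Icc ν (t 0)).image i) B ∧
        f = sqfMon K n B}).minimalPrimes ⊆
      (sfBorel K n ((Finset.Icc 1 s).image i)).minimalPrimes := by
  have ht0 : t 0 = s := hT.1
  rw [ht0] at hℓ2 ⊢
  have hν1 : 1 ≤ ν := by omega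
  have hνs : ν ≤ s := by omega
  have hge : ∀ x ∈ (Finset.Icc ν s).image i, ν ≤ x := by
    intro x hx
    obtain ⟨a, ha, rfl⟩ := Finset.mem_image.1 hx
    rw [Finset.mem_Icc] at ha
    exact ha.1.trans (self_le hmono h1 a (by omega) ha.2)
  set J := Ideal.span {f | ∃ B, BorelReachFrom ν ((Finset.Icc ν s).image i) B ∧
        f = sqfMon K n B} with hJ
  have hIJ : sfBorel K n ((Finset.Icc 1 s).image i) ≤ J := by
    refine Ideal.span_le.2 ?_
    rintro f ⟨B, hB, rfl⟩
    have hsplit : (Finset.Icc 1 s).image i =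
        (Finset.Icc 1 (ν - 1)).image i ∪ (Finset.Icc ν s).image i := by
      rw [← Finset.image_union]
      congr 1
      ext x
      simp only [Finset.mem_union, Finset.mem_Icc]
      omega
    rw [hsplit] at hB
    obtain ⟨D, T, rfl, -, -, -, hr⟩ := reach_top hν1 hB (by
      intro x hx y hy
      obtain ⟨a, ha, rfl⟩ := Finset.mem_image.1 hx
      obtain ⟨b, hb, rfl⟩ := Finset.mem_image.1 hy
      rw [Finset.mem_Icc] at ha hb
      exact strict hmono a b ha.1 (by omega) hb.2) (by
      rw [← hsplit]
      intro x hx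
      obtain ⟨a, ha, rfl⟩ := Finset.mem_image.1 hx
      rw [Finset.mem_Icc] at ha
      have := self_le hmono h1 a (by omega) ha.2
      omega) (by
      rw [Finset.card_image_of_injOn, Nat.card_Icc]
      · omega
      · intro a ha b hb hab
        simp only [Finset.coe_Icc, Set.mem_Icc] at ha hb
        rcases lt_trichotomy a b with h | h | h
        · have := strict hmono a b ha.1 h (by omega)
          omega
        · exact h
        · have := strict hmono b a hb.1 h (by omega)
          omega)
    exact Ideal.mem_of_dvd _ (sqfMon_dvd Finset.subset_union_right)
      (Ideal.subset_span ⟨T, hr, rfl⟩)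
  intro P hP
  have hPp : P.IsPrime := hP.1.1
  have hJP : J ≤ P := hP.1.2
  have hnot : ∀ j : Fin n, (j : ℕ) + 1 < ν → X j ∉ P := by
    intro j hj hjP
    let V : Set (Fin n) := {r | ν ≤ (r : ℕ) + 1 ∧ X r ∈ P}
    classical
    let φ : MvPolynomial (Fin n) K →ₐ[K] MvPolynomial (Fin n) K :=
      MvPolynomial.aeval (fun r => if r ∈ V then 0 else X r)
    have hφ : ∀ r, φ (X r) = if r ∈ V then 0 else X r := fun r => by simp [φ]
    have hcomp : (Ideal.Quotient.mkₐ K P).comp φ = Ideal.Quotient.mkₐ K P := by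
      apply MvPolynomial.algHom_ext
      intro r
      rw [AlgHom.comp_apply, hφ]
      split_ifs with hr
      · rw [map_zero]
        exact (Ideal.Quotient.eq_zero_iff_mem.2 hr.2).symm
      · rfl
    have hV : RingHom.ker φ ≤ P := by
      intro f hf
      rw [RingHom.mem_ker] at hf
      have h2 := DFunLike.congr_fun hcomp f
      rw [AlgHom.comp_apply, hf, map_zero] at h2
      exact Ideal.Quotient.eq_zero_iff_mem.1 h2.symm
    have hJV : J ≤ RingHom.ker φ := by
      refine Ideal.span_le.2 ?_
      rintro f ⟨B, hB, rfl⟩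
      obtain ⟨r, hrB, hrP⟩ := sqfMon_mem_of_mem P hPp (hJP (Ideal.subset_span ⟨B, hB, rfl⟩))
      refine Ideal.mem_of_dvd _ (X_dvd_sqfMon r hrB) ?_
      rw [RingHom.mem_ker, hφ, if_pos]
      exact ⟨reachFrom_ge hB hge _ hrB, hrP⟩
    have hm := hP.2 ⟨RingHom.ker_isPrime φ, hJV⟩ hV hjP
    rw [RingHom.mem_ker, hφ, if_neg] at hm
    · exact MvPolynomial.X_ne_zero j hm
    · intro h
      have := h.1
      omega
  refine ⟨⟨hPp, hIJ.trans hJP⟩, ?_⟩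
  rintro Q ⟨hQ, hIQ⟩ hQP
  refine hP.2 ⟨hQ, ?_⟩ hQP
  refine Ideal.span_le.2 ?_
  rintro f ⟨B, hB, rfl⟩
  have hst := reach_start hmono h1 (ν - 1) (by omega)
  rw [Nat.sub_add_cancel hν1] at hst
  have hreach := hst.trans (reach_lift hν1 hB hge)
  obtain ⟨r, hr, hrQ⟩ := sqfMon_mem_of_mem Q hQ (hIQ (Ideal.subset_span ⟨_, hreach, rfl⟩))
  rcases Finset.mem_union.1 hr with hr | hr
  · rw [Finset.mem_Icc] at hr
    exact absurd (hQP hrQ) (hnot r (by omega))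
  · exact Ideal.mem_of_dvd _ (X_dvd_sqfMon r hr) hrQ
end
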